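/- arXiv:2311.00649 — 2 statements merged into one kernel-verified Lean document; each statement's English description precedes it below -/
import Mathlib

section
/- Let Γ be a countable group with a locally finite normal subgroup H ⊴ Γ such that the quotient G = Γ/H is isomorphic to ℤ or to the infinite dihedral group D∞. Assume that for every minimal essentially free continuous action of Γ on a Cantor set Z, the orbit space Z/H is Hausdorff. Let Γ act minimally and continuously on an infinite compact metrizable space X. Then the action is almost finite in measure if and only if it is essentially free and has the small boundary property. -/
open scoped Pointwise
open MeasureTheory

namespace Paper

section Basic

variable (G : Type*) [Group G] (X : Type*) [TopologicalSpace X] [MulAction G X]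

/-- The action is minimal: every orbit is dense. -/
def Minimal : Prop := ∀ x : X, Dense (MulAction.orbit G x)

/-- The action is topologically free: every nontrivial fixed-point set is nowhere dense. -/
def TopFree : Prop := ∀ g : G, g ≠ 1 → interior (closure {x : X | g • x = x}) = (∅ : Set X)

variable [MeasurableSpace X]

/-- `μ` is a `G`-invariant Borel probability measure. -/
def InvProb (μ : Measure X) : Prop :=
  IsProbabilityMeasure μ ∧ ∀ g : G, Measure.map (fun x : X => g • x) μ = μ

/-- The action is essentially free. -/
def EssFree : Prop :=
  ∀ g : G, g ≠ 1 → ∀ μ : Measure X, InvProb G X μ → μ {x : X | g • x = x} = 0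

/-- The small boundary property. -/
def SBP : Prop :=
  ∀ (x : X) (U : Set X), IsOpen U → x ∈ U →
    ∃ V : Set X, IsOpen V ∧ x ∈ V ∧ V ⊆ U ∧
      ∀ μ : Measure X, InvProb G X μ → μ (frontier V) = 0

end Basic

/-- `S` is a `(K, ε)`-Følner set: `|KS \ S| < ε |S|`. -/
def IsFolner {G : Type*} [Group G] (K S : Finset G) (ε : ℝ) : Prop :=
  letI := Classical.decEq G
  (((K * S) \ S).card : ℝ) < ε * S.card

/-- Amenability in the Følner sense. -/
def FolnerAmenable (G : Type*) [Group G] : Prop :=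
  ∀ (K : Finset G) (ε : ℝ), 0 < ε → ∃ S : Finset G, IsFolner K S ε

/-- A finite family of towers forming a castle: all levels are pairwise disjoint. -/
def IsCastle (G : Type*) [Group G] (X : Type*) [MulAction G X] {n : ℕ}
    (S : Fin n → Finset G) (B : Fin n → Set X) : Prop :=
  ∀ (i j : Fin n), ∀ s ∈ S i, ∀ t ∈ S j, (i, s) ≠ (j, t) → Disjoint (s • B i) (t • B j)

/-- The union of all levels of a castle. -/
def CastleUnion (G : Type*) [Group G] (X : Type*) [MulAction G X] {n : ℕ}
    (S : Fin n → Finset G) (B : Fin n → Set X) : Set X :=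
  ⋃ i, ⋃ s ∈ S i, s • B i

/-- `C ≺ O` : dynamical subordination of a (closed) set `C` to `O`. -/
def Subord (G : Type*) [Group G] (X : Type*) [TopologicalSpace X] [MulAction G X]
    (C O : Set X) : Prop :=
  ∃ (n : ℕ) (V : Fin n → Set X) (g : Fin n → G),
    (∀ k, IsOpen (V k)) ∧ (C ⊆ ⋃ k, V k) ∧ (∀ k, g k • V k ⊆ O) ∧
      Pairwise fun k l => Disjoint (g k • V k) (g l • V l)

/-- `U ≺ O` for open `U`: every closed subset of `U` is subordinate to `O`. -/
def SubordOpen (G : Type*) [Group G] (X : Type*) [TopologicalSpace X] [MulAction G X]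
    (U O : Set X) : Prop :=
  ∀ C : Set X, IsClosed C → C ⊆ U → Subord G X C O

/-- Dynamical comparison. -/
def DynComparison (G : Type*) [Group G] (X : Type*) [TopologicalSpace X] [MulAction G X]
    [MeasurableSpace X] : Prop :=
  ∀ U O : Set X, IsOpen U → IsOpen O → U.Nonempty → O.Nonempty →
    (∀ μ : Measure X, InvProb G X μ → μ U < μ O) → SubordOpen G X U O

/-- Almost finiteness (Kerr). -/
def AlmostFinite (G X : Type*) [Group G] [MetricSpace X] [MulAction G X] : Prop :=
  ∀ (K : Finset G) (m : ℕ), 0 < m → ∀ ε : ℝ, 0 < ε →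
    ∃ (n : ℕ) (S : Fin n → Finset G) (B : Fin n → Set X),
      IsCastle G X S B ∧ (∀ i, IsOpen (B i)) ∧ (∀ i, IsFolner K (S i) ε) ∧
      (∀ i, ∀ s ∈ S i, Metric.diam (s • B i) < ε) ∧
      ∃ S' : Fin n → Finset G,
        (∀ i, S' i ⊆ S i ∧ ((S' i).card : ℝ) < (S i).card / m) ∧
        Subord G X (Set.univ \ CastleUnion G X S B) (CastleUnion G X S' B)

/-- Almost finiteness in measure (Kerr–Szabó). -/
def AlmostFiniteInMeasure (G X : Type*) [Group G] [MetricSpace X] [MulAction G X]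
    [MeasurableSpace X] : Prop :=
  ∀ (K : Finset G) (ε : ℝ), 0 < ε →
    ∃ (n : ℕ) (S : Fin n → Finset G) (B : Fin n → Set X),
      IsCastle G X S B ∧ (∀ i, IsOpen (B i)) ∧ (∀ i, IsFolner K (S i) ε) ∧
      (∀ i, ∀ s ∈ S i, Metric.diam (s • B i) < ε) ∧
      (⨆ μ : {μ : Measure X // InvProb G X μ},
        (μ : Measure X) (Set.univ \ CastleUnion G X S B)) < ENNReal.ofReal ε

/-- Every finitely generated subgroup is finite. -/
def LocallyFiniteGroup (G : Type*) [Group G] : Prop :=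
  ∀ H : Subgroup G, H.FG → (H : Set G).Finite

/-- `G` is virtually `ℤ`. -/
def VirtuallyZ (G : Type*) [Group G] : Prop :=
  ∃ H : Subgroup G, H.FiniteIndex ∧ Nonempty (H ≃* Multiplicative ℤ)

end Paper

open Paper

namespace Paper

open Set Filter Topology

section Translates

variable {G : Type*} [Group G] {X : Type*} [TopologicalSpace X] [MulAction G X]
  [ContinuousConstSMul G X]

theorem frontier_smul (g : G) (s : Set X) : frontier (g • s) = g • frontier s :=
  ((Homeomorph.smul g).image_frontier s).symm

end Translates

section InvariantMeasures

variable {G : Type*} [Group G] {X : Type*} [TopologicalSpace X] [MulAction G X]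
  [MeasurableSpace X]

/-- A set is universally null if every invariant Borel probability measure vanishes on it. -/
def UNull (G : Type*) [Group G] {X : Type*} [TopologicalSpace X] [MulAction G X]
    [MeasurableSpace X] (N : Set X) : Prop :=
  ∀ μ : Measure X, InvProb G X μ → μ N = 0

theorem UNull.mono {M N : Set X} (hN : UNull G N) (h : M ⊆ N) : UNull G M :=
  fun μ hμ => measure_mono_null h (hN μ hμ)

theorem UNull.union {M N : Set X} (hM : UNull G M) (hN : UNull G N) : UNull G (M ∪ N) :=
  fun μ hμ => measure_union_null (hM μ hμ) (hN μ hμ)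

theorem UNull.iUnion {ι : Sort*} [Countable ι] {N : ι → Set X} (h : ∀ i, UNull G (N i)) :
    UNull G (⋃ i, N i) :=
  fun μ hμ => measure_iUnion_null fun i => h i μ hμ

theorem UNull.empty : UNull G (∅ : Set X) := fun μ _ => measure_empty (μ := μ)

variable [BorelSpace X] [ContinuousConstSMul G X]

theorem InvProb.measure_smul {μ : Measure X} (hμ : InvProb G X μ) (g : G) (s : Set X) :
    μ (g • s) = μ s := by
  rw [← inv_inv g, ← Set.preimage_smul]
  conv_rhs => rw [← hμ.2 g⁻¹]
  exact ((Homeomorph.smul g⁻¹).toMeasurableEquiv.map_apply s).symm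

theorem UNull.smul {N : Set X} (hN : UNull G N) (g : G) : UNull G (g • N) :=
  fun μ hμ => by rw [hμ.measure_smul, hN μ hμ]

theorem measure_castle {ι : Type*} [Fintype ι] {S : ι → Finset G} {B : ι → Set X}
    (hC : ∀ (i j : ι), ∀ s ∈ S i, ∀ t ∈ S j, (i, s) ≠ (j, t) → Disjoint (s • B i) (t • B j))
    (hB : ∀ i, IsOpen (B i)) {μ : Measure X} (hμ : InvProb G X μ) :
    μ (⋃ i, ⋃ s ∈ S i, s • B i) = ∑ i, (S i).card * μ (B i) := by
  rw [measure_iUnion, tsum_fintype]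
  · refine Finset.sum_congr rfl fun i _ => ?_
    rw [measure_biUnion_finset]
    · simp [hμ.measure_smul]
    · intro s hs t ht hst
      exact hC i i s hs t ht (by simpa using hst)
    · exact fun s _ => ((hB i).smul s).measurableSet
  · intro i j hij
    simp only [Function.onFun, disjoint_iUnion_left, disjoint_iUnion_right]
    exact fun s hs t ht => hC _ _ _ ht _ hs (by simp [hij])
  · exact fun i => MeasurableSet.biUnion (Finset.countable_toSet _)
      fun s _ => ((hB i).smul s).measurableSet

end InvariantMeasures

theorem AlmostFiniteInMeasure.essFree {G : Type*} [Group G] {X : Type*} [MetricSpace X] [MulAction G X]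
    [MeasurableSpace X] [BorelSpace X] [ContinuousConstSMul G X] (h : AlmostFiniteInMeasure G X) : EssFree G X := by
  intro g hg μ hμ
  have hprob := hμ.1
  have key : ∀ ε : ℝ, 0 < ε → μ {x : X | g • x = x} ≤ ENNReal.ofReal ε := by
    intro ε hε
    classical
    obtain ⟨n, S, B, hC, hB, hS, -, hμC⟩ := h {g} (ε / 2) (by positivity)
    have hrem : μ (Set.univ \ CastleUnion G X S B) ≤ ENNReal.ofReal (ε / 2) :=
      (le_iSup (fun μ : {μ : Measure X // InvProb G X μ} =>
        (μ : Measure X) (Set.univ \ CastleUnion G X S B)) ⟨μ, hμ⟩).trans hμC.le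
    have hcard : ∀ i, (((S i).filter fun s => g * s ∉ S i).card : ℝ) ≤ ε / 2 * (S i).card := by
      intro i
      refine le_trans ?_ (hS i).le
      norm_cast
      refine Finset.card_le_card_of_injOn (fun s => g * s) ?_ (mul_right_injective g).injOn
      intro s hs
      simp only [Finset.coe_filter, mem_ofPred_eq] at hs
      simp only [Finset.mem_coe, Finset.mem_sdiff]
      exact ⟨Finset.mul_mem_mul (Finset.mem_singleton_self g) hs.1, hs.2⟩
    have hsub : {x : X | g • x = x} ⊆ (Set.univ \ CastleUnion G X S B) ∪
        ⋃ i, ⋃ s ∈ (S i).filter fun s => g * s ∉ S i, s • B i := by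
      intro x hx
      by_cases hxC : x ∈ CastleUnion G X S B
      · right
        simp only [CastleUnion, mem_iUnion] at hxC ⊢
        obtain ⟨i, s, hs, hxs⟩ := hxC
        refine ⟨i, s, Finset.mem_filter.2 ⟨hs, fun hgs => ?_⟩, hxs⟩
        have h1 : x ∈ (g * s) • B i := by
          rw [mul_smul, ← (show g • x = x from hx)]
          exact Set.smul_mem_smul_set hxs
        exact Set.disjoint_left.1 (hC i i s hs (g * s) hgs (by simp [hg])) hxs h1
      · exact Or.inl ⟨mem_univ _, hxC⟩
    have hsum : μ (⋃ i, ⋃ s ∈ (S i).filter fun s => g * s ∉ S i, s • B i)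
        ≤ ENNReal.ofReal (ε / 2) := by
      calc μ (⋃ i, ⋃ s ∈ (S i).filter fun s => g * s ∉ S i, s • B i)
          = ∑ i, ((S i).filter fun s => g * s ∉ S i).card * μ (B i) :=
            measure_castle (fun i j s hs t ht =>
              hC i j s (Finset.mem_filter.1 hs).1 t (Finset.mem_filter.1 ht).1) hB hμ
        _ ≤ ∑ i, ENNReal.ofReal (ε / 2) * ((S i).card * μ (B i)) := by
            refine Finset.sum_le_sum fun i _ => ?_
            rw [← mul_assoc]
            gcongr
            rw [← ENNReal.ofReal_natCast, ← ENNReal.ofReal_natCast,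
              ← ENNReal.ofReal_mul (by positivity)]
            exact ENNReal.ofReal_le_ofReal (hcard i)
        _ = ENNReal.ofReal (ε / 2) * μ (CastleUnion G X S B) := by
            rw [← Finset.mul_sum, CastleUnion, measure_castle hC hB hμ]
        _ ≤ ENNReal.ofReal (ε / 2) * 1 := by gcongr; exact prob_le_one
        _ = ENNReal.ofReal (ε / 2) := mul_one _
    calc μ {x : X | g • x = x} ≤ _ := measure_mono hsub
      _ ≤ _ := measure_union_le _ _
      _ ≤ ENNReal.ofReal (ε / 2) + ENNReal.ofReal (ε / 2) := add_le_add hrem hsum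
      _ = ENNReal.ofReal ε := by
          rw [← ENNReal.ofReal_add (by positivity) (by positivity), add_halves]
  refine le_antisymm (ENNReal.le_of_forall_pos_le_add fun ε hε _ => ?_) bot_le
  simpa using key ε hε

theorem isOpen_setOf_measure_lt {X : Type*} [MetricSpace X] [MeasurableSpace X] [BorelSpace X]
    {F : Set X} (hF : IsClosed F) (c : ENNReal) :
    IsOpen {ν : ProbabilityMeasure X | (ν : Measure X) F < c} := by
  rw [← isClosed_compl_iff, isClosed_iff_forall_filter]
  intro ν L hL hLs hLν
  have h1 : L.limsup (fun i : ProbabilityMeasure X => (i : Measure X) F) ≤ (ν : Measure X) F :=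
    ProbabilityMeasure.limsup_measure_closed_le_of_tendsto (μs := id) hLν hF
  have h2 : ∀ᶠ i : ProbabilityMeasure X in L, c ≤ (i : Measure X) F := by
    filter_upwards [hLs (mem_principal_self _)] with i hi
    simpa using hi
  have h3 : c ≤ L.limsup (fun i : ProbabilityMeasure X => (i : Measure X) F) :=
    le_limsup_of_frequently_le h2.frequently
  simpa using h3.trans h1

section Compactness

variable {G : Type*} [Group G] {X : Type*} [MetricSpace X] [CompactSpace X] [MulAction G X]
  [MeasurableSpace X] [BorelSpace X] [ContinuousConstSMul G X]

theorem isCompact_invProb :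
    IsCompact {ν : ProbabilityMeasure X | InvProb G X (ν : Measure X)} := by
  apply IsClosed.isCompact
  have : {ν : ProbabilityMeasure X | InvProb G X (ν : Measure X)} =
      ⋂ g : G, {ν : ProbabilityMeasure X |
        ν.map (continuous_const_smul g).measurable.aemeasurable = ν} := by
    ext ν
    simp only [InvProb, mem_ofPred_eq, mem_iInter]
    constructor
    · exact fun h g => Subtype.ext (h.2 g)
    · exact fun h => ⟨ν.2, fun g => congrArg Subtype.val (h g)⟩
  rw [this]
  exact isClosed_iInter fun g =>
    isClosed_eq (ProbabilityMeasure.continuous_map (continuous_const_smul g)) continuous_id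

/-- A closed set of pointwise small invariant measure has a thickening of uniformly small
invariant measure. -/
theorem exists_cthickening_measure_lt {A : Set X} (hA : IsClosed A) {c : ENNReal}
    (h : ∀ μ : Measure X, InvProb G X μ → μ A < c) :
    ∃ δ : ℝ, 0 < δ ∧ ∀ μ : Measure X, InvProb G X μ → μ (Metric.cthickening δ A) < c := by
  have hmono : Monotone fun k : ℕ => {ν : ProbabilityMeasure X |
      (ν : Measure X) (Metric.cthickening (1 / ((k : ℝ) + 1)) A) < c} := by
    intro k l hkl ν hν
    refine lt_of_le_of_lt (measure_mono (Metric.cthickening_mono ?_ A)) hν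
    exact one_div_le_one_div_of_le (by positivity) (by simpa using hkl)
  obtain ⟨k, hk⟩ := (isCompact_invProb (G := G) (X := X)).elim_directed_cover
    (fun k : ℕ => {ν : ProbabilityMeasure X |
      (ν : Measure X) (Metric.cthickening (1 / ((k : ℝ) + 1)) A) < c})
    (fun k => isOpen_setOf_measure_lt Metric.isClosed_cthickening c)
    (by
      intro ν hν
      obtain ⟨O, hAO, hO, hOc⟩ := A.exists_isOpen_lt_of_lt c (h ν hν)
      obtain ⟨δ, hδ, hδO⟩ := hA.isCompact.exists_cthickening_subset_open hO hAO
      obtain ⟨k, hk⟩ := exists_nat_one_div_lt hδ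
      exact mem_iUnion.2 ⟨k, lt_of_le_of_lt
        (measure_mono ((Metric.cthickening_mono hk.le A).trans hδO)) hOc⟩)
    (hmono.directed_le)
  exact ⟨1 / ((k : ℝ) + 1), by positivity, fun μ hμ => hk (a := ⟨μ, hμ.1⟩) hμ⟩

end Compactness

/-- Between a closed set and an open neighbourhood there is an open set whose boundary has
uniformly small invariant measure. -/
theorem AlmostFiniteInMeasure.exists_small_frontier {G : Type*} [Group G] {X : Type*}
    [MetricSpace X] [CompactSpace X] [MulAction G X] [MeasurableSpace X] [ContinuousConstSMul G X]
    (h : AlmostFiniteInMeasure G X)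
    {A U : Set X} (hA : IsClosed A) (hU : IsOpen U) (hAU : A ⊆ U) {ε : ℝ} (hε : 0 < ε) :
    ∃ V : Set X, IsOpen V ∧ A ⊆ V ∧ closure V ⊆ U ∧
      ∀ μ : Measure X, InvProb G X μ → μ (frontier V) < ENNReal.ofReal ε := by
  obtain ⟨δ, hδ, hδU⟩ := hA.isCompact.exists_cthickening_subset_open hU hAU
  obtain ⟨n, S, B, hC, hB, -, hdiam, hμC⟩ := h ∅ (min ε (δ / 2)) (by positivity)
  set W := Metric.thickening (δ / 2) A
  set V : Set X := W ∪ ⋃ i, ⋃ s ∈ S i, ⋃ _ : (s • B i ∩ W).Nonempty, s • B i with hV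
  have hVo : IsOpen V := Metric.isOpen_thickening.union <| isOpen_iUnion fun i =>
    isOpen_biUnion fun s _ => isOpen_iUnion fun _ => (hB i).smul s
  have hVδ : V ⊆ Metric.thickening δ A := by
    rintro x (hx | hx)
    · exact Metric.thickening_mono (by linarith) A hx
    · simp only [mem_iUnion] at hx
      obtain ⟨i, s, hs, ⟨y, hy, hyW⟩, hx⟩ := hx
      obtain ⟨a, ha, hya⟩ := Metric.mem_thickening_iff.1 hyW
      have h1 : dist x y ≤ Metric.diam (s • B i) :=
        Metric.dist_le_diam_of_mem (Metric.isBounded_of_compactSpace) hx hy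
      have h2 := (hdiam i s hs).trans_le (min_le_right _ _)
      exact Metric.mem_thickening_iff.2 ⟨a, ha, by linarith [dist_triangle x y a]⟩
  refine ⟨V, hVo, (Metric.self_subset_thickening (by positivity) A).trans subset_union_left,
    (closure_mono hVδ).trans ((Metric.closure_thickening_subset_cthickening δ A).trans hδU), ?_⟩
  intro μ hμ
  have hfr : frontier V ⊆ Set.univ \ CastleUnion G X S B := by
    refine fun x hx => ⟨mem_univ _, fun hxC => ?_⟩
    simp only [CastleUnion, mem_iUnion] at hxC
    obtain ⟨i, s, hs, hxs⟩ := hxC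
    rw [hVo.frontier_eq] at hx
    refine hx.2 (Or.inr ?_)
    simp only [mem_iUnion]
    obtain ⟨y, hy, hyV⟩ := mem_closure_iff.1 hx.1 _ ((hB i).smul s) hxs
    refine ⟨i, s, hs, ?_, hxs⟩
    rcases hyV with hyW | hyV
    · exact ⟨y, hy, hyW⟩
    · simp only [mem_iUnion] at hyV
      obtain ⟨j, t, ht, hne, hyt⟩ := hyV
      by_cases hij : (i, s) = (j, t)
      · obtain ⟨rfl, rfl⟩ := Prod.mk.inj hij
        exact hne
      · exact (Set.disjoint_left.1 (hC i j s hs t ht hij) hy hyt).elim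
  calc μ (frontier V) ≤ μ (Set.univ \ CastleUnion G X S B) := measure_mono hfr
    _ ≤ _ := le_iSup (fun μ : {μ : Measure X // InvProb G X μ} =>
        (μ : Measure X) (Set.univ \ CastleUnion G X S B)) ⟨μ, hμ⟩
    _ < _ := hμC
    _ ≤ _ := ENNReal.ofReal_le_ofReal (min_le_left _ _)

section Forward

variable {G : Type*} [Group G] {X : Type*} [MetricSpace X] [CompactSpace X] [MulAction G X]
  [MeasurableSpace X] [BorelSpace X] [ContinuousConstSMul G X]

theorem AlmostFiniteInMeasure.exists_squeeze (h : AlmostFiniteInMeasure G X)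
    {V U : Set X} (hU : IsOpen U) (hVU : closure V ⊆ U) {ε : ℝ} (hε : 0 < ε) :
    ∃ V' U' : Set X, IsOpen V' ∧ IsOpen U' ∧ V ⊆ V' ∧ closure V' ⊆ U' ∧ U' ⊆ U ∧
      ∀ μ : Measure X, InvProb G X μ → μ (closure U' \ V') < ENNReal.ofReal ε := by
  obtain ⟨V', hV', hVV', hV'U, hfr⟩ := h.exists_small_frontier isClosed_closure hU hVU hε
  obtain ⟨δ, hδ, hμ⟩ := exists_cthickening_measure_lt isClosed_frontier hfr
  refine ⟨V', (V' ∪ Metric.thickening δ (frontier V')) ∩ U, hV',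
    (hV'.union Metric.isOpen_thickening).inter hU, subset_closure.trans hVV', ?_,
    inter_subset_right, fun μ hμi => lt_of_le_of_lt (measure_mono ?_) (hμ μ hμi)⟩
  · refine subset_inter ?_ hV'U
    rw [closure_eq_self_union_frontier]
    exact union_subset_union_right _ (Metric.self_subset_thickening hδ _)
  · rintro x ⟨hx, hxV⟩
    have hx' := closure_mono inter_subset_left hx
    rw [closure_union] at hx'
    rcases hx' with hx' | hx'
    · exact Metric.self_subset_cthickening _ (by rw [hV'.frontier_eq]; exact ⟨hx', hxV⟩)
    · exact Metric.closure_thickening_subset_cthickening _ _ hx'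

theorem AlmostFiniteInMeasure.sbp (h : AlmostFiniteInMeasure G X) : SBP G X := by
  intro x U hU hxU
  let P := {p : Set X × Set X // IsOpen p.1 ∧ IsOpen p.2 ∧ closure p.1 ⊆ p.2}
  obtain ⟨V₀, hV₀, hxV₀, hV₀U, -⟩ :=
    h.exists_small_frontier isClosed_singleton hU (singleton_subset_iff.2 hxU) one_pos
  have step : ∀ (k : ℕ) (p : P), ∃ q : P, p.1.1 ⊆ q.1.1 ∧ q.1.2 ⊆ p.1.2 ∧
      ∀ μ : Measure X, InvProb G X μ →
        μ (closure q.1.2 \ q.1.1) < ENNReal.ofReal (1 / ((k : ℝ) + 1)) := by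
    intro k p
    obtain ⟨V', U', h1, h2, h3, h4, h5, h6⟩ :=
      h.exists_squeeze (ε := 1 / ((k : ℝ) + 1)) p.2.2.1 p.2.2.2 (by positivity)
    exact ⟨⟨(V', U'), h1, h2, h4⟩, h3, h5, h6⟩
  choose next hnext using step
  let f : ℕ → P := fun k => Nat.rec ⟨(V₀, U), hV₀, hU, hV₀U⟩ next k
  have hVm : Monotone fun k => (f k).1.1 := monotone_nat_of_le_succ fun k => (hnext k (f k)).1
  have hUm : Antitone fun k => (f k).1.2 := antitone_nat_of_succ_le fun k => (hnext k (f k)).2.1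
  have hVU : ∀ k l, (f k).1.1 ⊆ (f l).1.2 := by
    intro k l
    calc (f k).1.1 ⊆ (f (max k l)).1.1 := hVm (le_max_left _ _)
      _ ⊆ (f (max k l)).1.2 := subset_closure.trans (f (max k l)).2.2.2
      _ ⊆ (f l).1.2 := hUm (le_max_right _ _)
  have hVo : IsOpen (⋃ k, (f k).1.1) := isOpen_iUnion fun k => (f k).2.1
  refine ⟨⋃ k, (f k).1.1, hVo, mem_iUnion.2 ⟨0, hxV₀ rfl⟩, iUnion_subset fun k => hVU k 0, ?_⟩
  intro μ hμ
  refine le_antisymm (ENNReal.le_of_forall_pos_le_add fun ε hε _ => ?_) bot_le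
  obtain ⟨k, hk⟩ := exists_nat_one_div_lt (show (0 : ℝ) < ε from hε)
  rw [zero_add]
  calc μ (frontier (⋃ k, (f k).1.1)) ≤ μ (closure (f (k + 1)).1.2 \ (f (k + 1)).1.1) := by
        refine measure_mono ?_
        rw [hVo.frontier_eq]
        exact sdiff_subset_sdiff (closure_mono (iUnion_subset fun l => hVU l (k + 1)))
          (subset_iUnion (fun k => (f k).1.1) (k + 1))
    _ ≤ ENNReal.ofReal (1 / ((k : ℝ) + 1)) := ((hnext k (f k)).2.2 μ hμ).le
    _ ≤ ENNReal.ofReal ε := ENNReal.ofReal_le_ofReal hk.le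
    _ = ε := ENNReal.ofReal_coe_nnreal

end Forward

section Coordinates

/-- A finite-to-one map to the integers which is `1`-Lipschitz-equivalent, up to reflections,
to right translation: the group looks like a line seen through `p`. -/
structure LineCoord {Γ : Type*} [Group Γ] (p : Γ → ℤ) : Prop where
  one : p 1 = 0
  dist_mul : ∀ g h k, |p (g * k) - p (h * k)| = |p g - p h|
  surj : Function.Surjective p
  finite : (p ⁻¹' {0}).Finite

namespace LineCoord

variable {Γ : Type*} [Group Γ] {p : Γ → ℤ}

theorem abs_inv (hp : LineCoord p) (k : Γ) : |p k⁻¹| = |p k| := by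
  have := hp.dist_mul 1 k k⁻¹
  simpa [hp.one] using this

theorem abs_mul_inv (hp : LineCoord p) (g k : Γ) : |p (g * k⁻¹)| = |p g - p k| := by
  have := hp.dist_mul g k k⁻¹
  simpa [hp.one] using this

theorem abs_left_mul (hp : LineCoord p) (k g : Γ) : |p (k * g) - p g| = |p k| := by
  have := hp.dist_mul k 1 g
  simpa [hp.one] using this

theorem fiber_subset (hp : LineCoord p) (k : Γ) : p ⁻¹' {p k} ⊆ (fun g => g * k) '' (p ⁻¹' {0}) := by
  intro g hg
  refine ⟨g * k⁻¹, ?_, by simp⟩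
  have := hp.abs_mul_inv g k
  rw [show p g = p k from hg] at this
  simpa using this

theorem finite_preimage (hp : LineCoord p) (I : Finset ℤ) : (p ⁻¹' (I : Set ℤ)).Finite := by
  refine I.finite_toSet.preimage' fun j _ => ?_
  obtain ⟨k, rfl⟩ := hp.surj j
  exact (hp.finite.image _).subset (hp.fiber_subset k)

/-- The finite set of group elements with coordinate in `I`. -/
noncomputable def cell (hp : LineCoord p) (I : Finset ℤ) : Finset Γ := (hp.finite_preimage I).toFinset

@[simp] theorem mem_cell (hp : LineCoord p) {I : Finset ℤ} {g : Γ} : g ∈ hp.cell I ↔ p g ∈ I := by simp [cell]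

theorem card_le_card_cell (hp : LineCoord p) (I : Finset ℤ) : I.card ≤ (hp.cell I).card := by
  refine Finset.card_le_card_of_surjOn p fun j hj => ?_
  obtain ⟨k, rfl⟩ := hp.surj j
  exact ⟨k, by simpa using hj, rfl⟩

theorem card_cell_le (hp : LineCoord p) (I : Finset ℤ) : (hp.cell I).card ≤ (p ⁻¹' {0}).ncard * I.card := by
  classical
  refine Finset.card_le_mul_card_image_of_maps_to (f := p) (fun g hg => by simpa using hg) _ ?_
  intro j _
  obtain ⟨k, rfl⟩ := hp.surj j
  rw [← Set.ncard_coe_finset]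
  refine le_trans (Set.ncard_le_ncard ?_ (hp.finite.image fun g => g * k))
    (Set.ncard_image_le hp.finite)
  intro g hg
  simp only [Finset.coe_filter, mem_ofPred_eq] at hg
  exact hp.fiber_subset k hg.2

/-- Long intervals have Følner preimages. -/
theorem exists_isFolner (hp : LineCoord p) (K : Finset Γ) {ε : ℝ} (hε : 0 < ε) :
    ∃ N : ℕ, ∀ I : Finset ℤ, (∀ a ∈ I, ∀ c ∈ I, ∀ b, a ≤ b → b ≤ c → b ∈ I) →
      N ≤ I.card → IsFolner K (hp.cell I) ε := by
  classical
  set c : ℕ := ∑ k ∈ K, (p k).natAbs with hc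
  have hcK : ∀ k ∈ K, |p k| ≤ c := by
    intro k hk
    rw [Int.abs_eq_natAbs]
    exact_mod_cast Finset.single_le_sum (f := fun k => (p k).natAbs) (fun _ _ => Nat.zero_le _) hk
  set m := (p ⁻¹' {0}).ncard
  obtain ⟨N, hN⟩ := exists_nat_gt ((m * (2 * c) : ℕ) / ε)
  refine ⟨N, fun I hI hNI => ?_⟩
  have hN0 : 0 < N := by
    have : (0 : ℝ) < N := lt_of_le_of_lt (by positivity) hN
    exact_mod_cast this
  have hne : I.Nonempty := Finset.card_pos.1 (hN0.trans_le hNI)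
  unfold IsFolner
  set a := I.min' hne with ha
  set b := I.max' hne with hb
  have hsub : ∀ d : DecidableEq Γ, (K * hp.cell I) \ hp.cell I ⊆
      hp.cell (Finset.Ico (a - c) a ∪ Finset.Ioc b (b + c)) := by
    intro _ g hg
    obtain ⟨hg, hgI⟩ := Finset.mem_sdiff.1 hg
    obtain ⟨k, hk, s, hs, rfl⟩ := Finset.mem_mul.1 hg
    rw [mem_cell] at hs hgI ⊢
    have h1 := I.min'_le _ hs
    have h2 := I.le_max' _ hs
    have h3 : |p (k * s) - p s| ≤ c := (hp.abs_left_mul k s).trans_le (hcK k hk)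
    have h4 := abs_le.1 h3
    have h5 : ¬ (a ≤ p (k * s) ∧ p (k * s) ≤ b) := fun h =>
      hgI (hI a (I.min'_mem hne) b (I.max'_mem hne) _ h.1 h.2)
    simp only [Finset.mem_union, Finset.mem_Ico, Finset.mem_Ioc]
    omega
  have hle : ((K * hp.cell I) \ hp.cell I).card ≤ m * (2 * c) := by
    refine (Finset.card_le_card (hsub _)).trans ((hp.card_cell_le _).trans ?_)
    refine Nat.mul_le_mul_left _ ((Finset.card_union_le _ _).trans ?_)
    simp only [Int.card_Ico, Int.card_Ioc]
    omega
  have h1 : ((m * (2 * c) : ℕ) : ℝ) < ε * N := by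
    rw [div_lt_iff₀ hε] at hN
    linarith
  have h2 : (N : ℝ) ≤ ((hp.cell I).card : ℝ) := by
    exact_mod_cast hNI.trans (hp.card_le_card_cell I)
  have h3 : ε * (N : ℝ) ≤ ε * ((hp.cell I).card : ℝ) := by gcongr
  refine lt_of_le_of_lt ?_ (h1.trans_le h3)
  convert Nat.cast_le (α := ℝ).2 hle

end LineCoord

/-- The coordinates of a truncated Voronoi cell around `0` relative to competitors in `Q`. -/
noncomputable def voronoi (n : ℕ) (Q : Finset ℤ) : Finset ℤ :=
  (Finset.Ioo (-n : ℤ) n).filter fun j => ∀ q ∈ Q, |j| < |j - q|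

theorem mem_voronoi {n : ℕ} {Q : Finset ℤ} {j : ℤ} :
    j ∈ voronoi n Q ↔ |j| < n ∧ ∀ q ∈ Q, |j| < |j - q| := by
  simp [voronoi, abs_lt]

theorem voronoi_ordConnected {n : ℕ} {Q : Finset ℤ} (a : ℤ) (ha : a ∈ voronoi n Q) (c : ℤ)
    (hc : c ∈ voronoi n Q) (b : ℤ) (hab : a ≤ b) (hbc : b ≤ c) : b ∈ voronoi n Q := by
  rw [mem_voronoi] at *
  refine ⟨by rw [abs_lt] at *; omega, fun q hq => ?_⟩
  have h1 := ha.2 q hq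
  have h2 := hc.2 q hq
  grind

theorem le_card_voronoi {N : ℕ} {Q : Finset ℤ} (hQ : ∀ q ∈ Q, 2 * (N : ℤ) ≤ |q|) :
    N ≤ (voronoi (2 * N) Q).card := by
  have : (Finset.Ico (0 : ℤ) N).card ≤ (voronoi (2 * N) Q).card := by
    refine Finset.card_le_card fun j hj => ?_
    rw [Finset.mem_Ico] at hj
    rw [mem_voronoi]
    refine ⟨by rw [abs_lt]; omega, fun q hq => ?_⟩
    have := hQ q hq
    grind
  simpa using this

/-- A point at least as close to `0` as to every competitor is adjacent to the Voronoi cell. -/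
theorem exists_mem_voronoi_near {n : ℕ} {Q : Finset ℤ} (hn : 0 < n) (hQ : ∀ q ∈ Q, (n : ℤ) ≤ |q|)
    {j : ℤ} (hj : |j| < n) (hjQ : ∀ q ∈ Q, |j| ≤ |j - q|) :
    ∃ i ∈ voronoi n Q, |j - i| ≤ 1 := by
  have hj' := abs_lt.1 hj
  rcases lt_trichotomy j 0 with h | h | h
  · refine ⟨j + 1, mem_voronoi.2 ⟨abs_lt.2 ⟨by omega, by omega⟩, fun q hq => ?_⟩, by simp⟩
    have h1 := hQ q hq
    have h2 := hjQ q hq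
    rcases abs_cases q with hq' | hq' <;> rcases abs_cases j with ha | ha <;>
      rcases abs_cases (j - q) with hb | hb <;> rcases abs_cases (j + 1) with hc | hc <;>
      rcases abs_cases (j + 1 - q) with hd | hd <;> omega
  · refine ⟨j, mem_voronoi.2 ⟨hj, fun q hq => ?_⟩, by simp⟩
    have h1 := hQ q hq
    subst h
    simp only [abs_zero, zero_sub, abs_neg]
    omega
  · refine ⟨j - 1, mem_voronoi.2 ⟨abs_lt.2 ⟨by omega, by omega⟩, fun q hq => ?_⟩, by simp⟩
    have h1 := hQ q hq
    have h2 := hjQ q hq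
    rcases abs_cases q with hq' | hq' <;> rcases abs_cases j with ha | ha <;>
      rcases abs_cases (j - q) with hb | hb <;> rcases abs_cases (j - 1) with hc | hc <;>
      rcases abs_cases (j - 1 - q) with hd | hd <;> omega

end Coordinates

section Markers

/-- An open set whose boundary is universally null. -/
def Tame (G : Type*) [Group G] {X : Type*} [TopologicalSpace X] [MulAction G X]
    [MeasurableSpace X] (V : Set X) : Prop :=
  IsOpen V ∧ UNull G (frontier V)

section Tame

variable {G : Type*} [Group G] {X : Type*} [TopologicalSpace X] [MulAction G X]
  [MeasurableSpace X]

theorem Tame.empty : Tame G (∅ : Set X) := ⟨isOpen_empty, by simpa using UNull.empty⟩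

theorem Tame.union {V W : Set X} (hV : Tame G V) (hW : Tame G W) : Tame G (V ∪ W) := by
  refine ⟨hV.1.union hW.1, (hV.2.union hW.2).mono ((frontier_union_subset V W).trans ?_)⟩
  exact union_subset_union inter_subset_left inter_subset_right

theorem Tame.diff_closure {V W : Set X} (hV : Tame G V) (hW : Tame G W) :
    Tame G (V \ closure W) := by
  refine ⟨hV.1.sdiff isClosed_closure, (hV.2.union hW.2).mono ?_⟩
  rw [sdiff_eq]
  refine (frontier_inter_subset V _).trans (union_subset_union inter_subset_left ?_)
  rw [frontier_compl]
  exact inter_subset_right.trans frontier_closure_subset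

theorem Tame.biUnion {ι : Type*} (s : Finset ι) {V : ι → Set X} (h : ∀ i ∈ s, Tame G (V i)) :
    Tame G (⋃ i ∈ s, V i) := by
  classical
  induction s using Finset.induction_on with
  | empty => simpa using Tame.empty
  | insert a s ha ih =>
    rw [Finset.set_biUnion_insert]
    exact (h a (Finset.mem_insert_self a s)).union
      (ih fun i hi => h i (Finset.mem_insert_of_mem hi))

theorem Tame.smul [BorelSpace X] [ContinuousConstSMul G X] {V : Set X} (hV : Tame G V) (g : G) :
    Tame G (g • V) :=
  ⟨hV.1.smul g, by rw [frontier_smul]; exact hV.2.smul g⟩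

end Tame

section Greedy

variable {G : Type*} [Group G] {X : Type*} [TopologicalSpace X] [MulAction G X]

/-- Greedy selection: at stage `j` add the part of `U j` away from the `L`-translates of
what has been selected so far. -/
def greedy (L : Finset G) (U : ℕ → Set X) : ℕ → Set X
  | 0 => ∅
  | j + 1 => greedy L U j ∪ (U j \ closure (⋃ g ∈ L, g • greedy L U j))

/-- The part added at stage `j` of the greedy selection. -/
def layer (L : Finset G) (U : ℕ → Set X) (j : ℕ) : Set X :=
  U j \ closure (⋃ g ∈ L, g • greedy L U j)

theorem greedy_mono (L : Finset G) (U : ℕ → Set X) : Monotone (greedy L U) :=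
  monotone_nat_of_le_succ fun _ => subset_union_left

theorem layer_subset_greedy (L : Finset G) (U : ℕ → Set X) {i j : ℕ} (h : i < j) :
    layer L U i ⊆ greedy L U j :=
  (subset_union_right : layer L U i ⊆ greedy L U (i + 1)).trans (greedy_mono L U h)

theorem greedy_eq_iUnion (L : Finset G) (U : ℕ → Set X) (j : ℕ) :
    greedy L U j = ⋃ i : Fin j, layer L U i := by
  refine subset_antisymm ?_ (iUnion_subset fun i => layer_subset_greedy L U i.2)
  induction j with
  | zero => exact empty_subset _
  | succ j ih =>
    refine union_subset (ih.trans ?_) ?_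
    · exact iUnion_subset fun i => subset_iUnion (fun i : Fin (j + 1) => layer L U i) i.castSucc
    · exact subset_iUnion (fun i : Fin (j + 1) => layer L U i) (Fin.last j)

theorem notMem_layer_of_mem_greedy {L : Finset G} {U : ℕ → Set X} {g : G} (hg : g ∈ L) {j : ℕ}
    {x : X} (hx : x ∈ greedy L U j) : g • x ∉ layer L U j :=
  fun h => h.2 (subset_closure (mem_biUnion hg (Set.smul_mem_smul_set hx)))

theorem greedy_separated {L : Finset G} (hL : ∀ g ∈ L, g⁻¹ ∈ L) {U : ℕ → Set X}
    (hU : ∀ j, ∀ g ∈ L, g ≠ 1 → Disjoint (U j) (g • U j)) (j : ℕ) :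
    ∀ x ∈ greedy L U j, ∀ g ∈ L, g ≠ 1 → g • x ∉ greedy L U j := by
  induction j with
  | zero => exact fun x hx => hx.elim
  | succ j ih =>
    rintro x (hx | hx) g hg hg1 (hgx | hgx)
    · exact ih x hx g hg hg1 hgx
    · exact notMem_layer_of_mem_greedy hg hx hgx
    · have := notMem_layer_of_mem_greedy (hL g hg) hgx
      rw [inv_smul_smul] at this
      exact this hx
    · exact Set.disjoint_left.1 (hU j g hg hg1) hgx.1 (Set.smul_mem_smul_set hx.1)

theorem tame_greedy [ContinuousConstSMul G X] [MeasurableSpace X] [BorelSpace X] {L : Finset G}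
    {U : ℕ → Set X} (hU : ∀ j, Tame G (U j)) (j : ℕ) : Tame G (greedy L U j) := by
  induction j with
  | zero => exact Tame.empty
  | succ j ih => exact ih.union ((hU j).diff_closure (Tame.biUnion L fun g _ => ih.smul g))

end Greedy

variable {G : Type*} [Group G] {X : Type*} [MetricSpace X] [MulAction G X]
  [MeasurableSpace X] [ContinuousConstSMul G X]

theorem exists_tame_nhd (hsbp : SBP G X) (E L : Finset G) {ε : ℝ} (hε : 0 < ε) {x : X}
    (hx : ∀ g ∈ E, g • x ≠ x) :
    ∃ U : Set X, Tame G U ∧ x ∈ U ∧ (∀ g ∈ E, Disjoint U (g • U)) ∧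
      ∀ g ∈ L, Metric.diam (g • U) < ε := by
  have hE : ∀ g ∈ E, ∃ O ∈ 𝓝 x, ∀ U ⊆ O, Disjoint U (g • U) := by
    intro g hg
    obtain ⟨O, O', hO, hO', hxO, hxO', hd⟩ := t2_separation (hx g hg).symm
    refine ⟨O ∩ (fun y => g • y) ⁻¹' O', inter_mem (hO.mem_nhds hxO)
      ((continuous_const_smul g).continuousAt (hO'.mem_nhds hxO')), fun U hU => ?_⟩
    refine hd.mono (fun y hy => (hU hy).1) ?_
    rintro _ ⟨y, hy, rfl⟩
    exact (hU hy).2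
  have hL : ∀ g ∈ L, ∃ O ∈ 𝓝 x, ∀ U ⊆ O, Metric.diam (g • U) < ε := by
    intro g _
    refine ⟨(fun y => g • y) ⁻¹' Metric.ball (g • x) (ε / 4),
      (continuous_const_smul g).continuousAt (Metric.ball_mem_nhds _ (by positivity)),
      fun U hU => ?_⟩
    have h1 : g • U ⊆ Metric.ball (g • x) (ε / 4) := by
      rintro _ ⟨y, hy, rfl⟩
      exact hU hy
    calc Metric.diam (g • U) ≤ Metric.diam (Metric.ball (g • x) (ε / 4)) :=
          Metric.diam_mono h1 Metric.isBounded_ball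
      _ ≤ 2 * (ε / 4) := Metric.diam_ball (by positivity)
      _ < ε := by linarith
  choose! O hO hOE using hE
  choose! P hP hPL using hL
  have hmem : (⋂ g ∈ E, O g) ∩ (⋂ g ∈ L, P g) ∈ 𝓝 x :=
    inter_mem ((biInter_finset_mem E).2 hO) ((biInter_finset_mem L).2 hP)
  obtain ⟨V, hV, hVo, hxV⟩ := mem_nhds_iff.1 hmem
  obtain ⟨U, hU, hxU, hUV, hμ⟩ := hsbp x V hVo hxV
  have hsub := hUV.trans hV
  exact ⟨U, ⟨hU, hμ⟩, hxU,
    fun g hg => hOE g hg U (hsub.trans (inter_subset_left.trans (biInter_subset_of_mem hg))),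
    fun g hg => hPL g hg U (hsub.trans (inter_subset_right.trans (biInter_subset_of_mem hg)))⟩

/-- Existence of markers: an open set with null boundary, separated with respect to a finite
window `L`, decomposed into small pieces, and whose `L`-translates cover all of the space up to a
set of uniformly small invariant measure. -/
theorem exists_markers [CompactSpace X] [BorelSpace X] (hfree : EssFree G X) (hsbp : SBP G X)
    {L : Finset G} (hL1 : 1 ∈ L) (hL : ∀ g ∈ L, g⁻¹ ∈ L) {ε : ℝ} (hε : 0 < ε) {c : ENNReal}
    (hc : 0 < c) :
    ∃ (N : ℕ) (D : Fin N → Set X) (W : Set X), (∀ i, IsOpen (D i)) ∧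
      (Pairwise fun i j => Disjoint (D i) (D j)) ∧ Tame G (⋃ i, D i) ∧
      (∀ x ∈ ⋃ i, D i, ∀ g ∈ L, g ≠ 1 → g • x ∉ ⋃ i, D i) ∧
      (∀ i, ∀ g ∈ L, Metric.diam (g • D i) < ε) ∧
      (∀ μ : Measure X, InvProb G X μ → μ W < c) ∧
      ∀ y, y ∈ W ∨ ∃ g ∈ L, g⁻¹ • y ∈ ⋃ i, D i := by
  classical
  have hF : IsClosed (⋃ g ∈ L.erase 1, {x : X | g • x = x}) :=
    isClosed_biUnion_finset fun g _ => isClosed_eq (continuous_const_smul g) continuous_id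
  obtain ⟨δ, hδ, hμ⟩ := exists_cthickening_measure_lt (G := G) (c := c) hF (by
    intro μ hμ
    have h0 : μ (⋃ g ∈ L.erase 1, {x : X | g • x = x}) = 0 :=
      (measure_biUnion_null_iff (Finset.countable_toSet (L.erase 1))).2
        fun g hg => hfree g (Finset.ne_of_mem_erase hg) μ hμ
    rwa [h0])
  set F := ⋃ g ∈ L.erase 1, {x : X | g • x = x}
  have hcpt : IsCompact (Metric.thickening δ F)ᶜ :=
    Metric.isOpen_thickening.isClosed_compl.isCompact
  have hloc : ∀ x ∈ (Metric.thickening δ F)ᶜ, ∃ U : Set X, Tame G U ∧ x ∈ U ∧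
      (∀ g ∈ L.erase 1, Disjoint U (g • U)) ∧ ∀ g ∈ L, Metric.diam (g • U) < ε := by
    intro x hx
    refine exists_tame_nhd hsbp _ _ hε fun g hg hgx => hx ?_
    exact Metric.self_subset_thickening hδ F (mem_biUnion hg hgx)
  choose! V hV hxV hVE hVL using hloc
  obtain ⟨t, ht, hcov⟩ := hcpt.elim_nhds_subcover V fun x hx => (hV x hx).1.mem_nhds (hxV x hx)
  obtain ⟨l, hl⟩ : ∃ l : List X, ∀ x, x ∈ l ↔ x ∈ t := ⟨t.toList, by simp⟩
  let U : ℕ → Set X := fun j => if h : j < l.length then V l[j] else ∅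
  have hUcases : ∀ j, U j = ∅ ∨ ∃ x ∈ (Metric.thickening δ F)ᶜ, U j = V x := by
    intro j
    by_cases h : j < l.length
    · exact Or.inr ⟨l[j], ht _ ((hl _).1 (List.getElem_mem h)), by simp [U, h]⟩
    · exact Or.inl (by simp [U, h])
  have hUt : ∀ j, Tame G (U j) := by
    intro j
    rcases hUcases j with h | ⟨x, hx, h⟩ <;> rw [h]
    · exact Tame.empty
    · exact hV x hx
  have hUE : ∀ j, ∀ g ∈ L, g ≠ 1 → Disjoint (U j) (g • U j) := by
    intro j g hg hg1
    rcases hUcases j with h | ⟨x, hx, h⟩ <;> rw [h]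
    · simp
    · exact hVE x hx g (Finset.mem_erase.2 ⟨hg1, hg⟩)
  have hUL : ∀ j, ∀ g ∈ L, Metric.diam (g • U j) < ε := by
    intro j g hg
    rcases hUcases j with h | ⟨x, hx, h⟩ <;> rw [h]
    · simpa using hε
    · exact hVL x hx g hg
  set N := l.length
  have hT : ∀ j, Tame G (⋃ g ∈ L, g • greedy L U j) := fun j =>
    Tame.biUnion L fun g _ => (tame_greedy hUt j).smul g
  set M : Set X := ⋃ j, frontier (⋃ g ∈ L, g • greedy L U j)
  have hM : UNull G M := UNull.iUnion fun j => (hT j).2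
  refine ⟨N, fun i => layer L U i, Metric.thickening δ F ∪ M, ?_, ?_, ?_, ?_, ?_, ?_, ?_⟩
  · exact fun i => (hUt i).1.sdiff isClosed_closure
  · have : ∀ i j : Fin N, i < j → Disjoint (layer L U i) (layer L U j) := by
      intro i j hij
      refine Set.disjoint_left.2 fun x hxi hxj => ?_
      have := notMem_layer_of_mem_greedy hL1 (layer_subset_greedy L U hij hxi)
      rw [one_smul] at this
      exact this hxj
    intro i j hij
    rcases lt_or_gt_of_ne hij with h | h
    · exact this i j h
    · exact (this j i h).symm
  · rw [← greedy_eq_iUnion]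
    exact tame_greedy hUt N
  · rw [← greedy_eq_iUnion]
    exact greedy_separated hL hUE N
  · intro i g hg
    refine lt_of_le_of_lt (Metric.diam_mono ?_ Metric.isBounded_of_compactSpace) (hUL i g hg)
    exact Set.smul_set_mono sdiff_subset
  · intro μ hμi
    refine (measure_union_le _ _).trans_lt ?_
    rw [hM μ hμi, add_zero]
    exact (measure_mono (Metric.thickening_subset_cthickening δ F)).trans_lt (hμ μ hμi)
  · intro y
    rw [← greedy_eq_iUnion]
    by_cases hy : y ∈ Metric.thickening δ F
    · exact Or.inl (Or.inl hy)
    obtain ⟨x, hxt, hyx⟩ := mem_iUnion₂.1 (hcov hy)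
    obtain ⟨j, hj, rfl⟩ := List.mem_iff_getElem.1 ((hl x).2 hxt)
    have hyU : y ∈ U j := by simpa [U, hj] using hyx
    by_cases hy1 : y ∈ ⋃ g ∈ L, g • greedy L U j
    · obtain ⟨g, hg, hyg⟩ := mem_iUnion₂.1 hy1
      exact Or.inr ⟨g, hg, greedy_mono L U hj.le (Set.mem_smul_set_iff_inv_smul_mem.1 hyg)⟩
    · by_cases hy2 : y ∈ closure (⋃ g ∈ L, g • greedy L U j)
      · refine Or.inl (Or.inr (mem_iUnion.2 ⟨j, ?_⟩))
        rw [(hT j).1.frontier_eq]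
        exact ⟨hy2, hy1⟩
      · refine Or.inr ⟨1, hL1, ?_⟩
        rw [inv_one, one_smul]
        exact layer_subset_greedy L U hj ⟨hyU, hy2⟩

end Markers

section Castle

theorem IsFolner.mono {G : Type*} [Group G] {K K' S : Finset G} {ε ε' : ℝ} (h : IsFolner K' S ε)
    (hK : K ⊆ K') (hε : ε ≤ ε') : IsFolner K S ε' := by
  classical
  refine lt_of_le_of_lt ?_ (h.trans_le (by gcongr))
  exact_mod_cast Finset.card_le_card
    (Finset.sdiff_subset_sdiff (Finset.mul_subset_mul_right hK) subset_rfl)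

theorem IsFolner.card_mul_le {G : Type*} [Group G] [DecidableEq G] {K S : Finset G} {ε : ℝ}
    (h : IsFolner K S ε) : ((K * S).card : ℝ) ≤ (1 + ε) * S.card := by
  have h1 : (((K * S) \ S).card : ℝ) < ε * S.card := by
    unfold IsFolner at h
    convert h
  have h2 : ((K * S).card : ℝ) ≤ ((K * S) \ S).card + S.card := by
    exact_mod_cast (Finset.card_le_card (by simp : K * S ⊆ (K * S) \ S ∪ S)).trans
      (Finset.card_union_le _ _)
  linarith

variable {G : Type*} [Group G] {X : Type*} [MetricSpace X] [MulAction G X]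
  [MeasurableSpace X] [BorelSpace X] [ContinuousConstSMul G X]

/-- The castle condition indexed by an arbitrary finite type, in terms of expansions of the
levels almost covering the space. -/
theorem almostFiniteInMeasure_of_expansions
    (h : ∀ (K : Finset G) (ε : ℝ), 0 < ε →
      ∃ (ι : Type) (_ : Fintype ι) (S : ι → Finset G) (B : ι → Set X) (T : ι → Finset G)
        (W : Set X),
        (∀ (i j : ι), ∀ s ∈ S i, ∀ t ∈ S j, (i, s) ≠ (j, t) → Disjoint (s • B i) (t • B j)) ∧
        (∀ i, IsOpen (B i)) ∧ (∀ i, IsFolner K (S i) ε) ∧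
        (∀ i, ∀ s ∈ S i, Metric.diam (s • B i) < ε) ∧
        (∀ i, ((T i).card : ℝ) ≤ (1 + ε) * (S i).card) ∧
        (∀ μ : Measure X, InvProb G X μ → μ W ≤ ENNReal.ofReal ε) ∧
        ∀ y, y ∈ W ∨ y ∈ ⋃ i, ⋃ s ∈ T i, s • B i) : AlmostFiniteInMeasure G X := by
  intro K ε hε
  obtain ⟨ι, _, S, B, T, W, hC, hB, hS, hd, hT, hW, hcov⟩ := h K (ε / 3) (by positivity)
  let e : Fin (Fintype.card ι) ≃ ι := (Fintype.equivFin ι).symm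
  refine ⟨Fintype.card ι, S ∘ e, B ∘ e, ?_, fun i => hB _, fun i => ?_, fun i s hs => ?_, ?_⟩
  · intro i j s hs t ht hne
    refine hC (e i) (e j) s hs t ht fun h => hne ?_
    simpa using h
  · exact (hS (e i)).mono subset_rfl (by linarith)
  · exact (hd (e i) s hs).trans (by linarith)
  have hcast : CastleUnion G X (S ∘ e) (B ∘ e) = ⋃ i, ⋃ s ∈ S i, s • B i :=
    e.surjective.iUnion_comp fun i => ⋃ s ∈ S i, s • B i
  rw [hcast]
  have hopen : IsOpen (⋃ i, ⋃ s ∈ S i, s • B i) :=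
    isOpen_iUnion fun i => isOpen_biUnion fun s _ => (hB i).smul s
  have key : ∀ μ : {μ : Measure X // InvProb G X μ},
      (μ : Measure X) (Set.univ \ ⋃ i, ⋃ s ∈ S i, s • B i) ≤ ENNReal.ofReal (ε / 3 + ε / 3) := by
    rintro ⟨μ, hμ⟩
    have hprob := hμ.1
    set c := ENNReal.ofReal (ε / 3)
    have hsum : μ (⋃ i, ⋃ s ∈ T i, s • B i) ≤ c + μ (⋃ i, ⋃ s ∈ S i, s • B i) := by
      calc μ (⋃ i, ⋃ s ∈ T i, s • B i) ≤ ∑ i, (T i).card * μ (B i) := by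
            refine (measure_iUnion_fintype_le _ _).trans (Finset.sum_le_sum fun i _ => ?_)
            refine (measure_biUnion_finset_le _ _).trans ?_
            simp [hμ.measure_smul]
        _ ≤ ∑ i, (1 + c) * ((S i).card * μ (B i)) := by
            refine Finset.sum_le_sum fun i _ => ?_
            rw [← mul_assoc]
            gcongr
            rw [← ENNReal.ofReal_natCast, ← ENNReal.ofReal_natCast, ← ENNReal.ofReal_one,
              ← ENNReal.ofReal_add (by positivity) (by positivity),
              ← ENNReal.ofReal_mul (by positivity)]
            exact ENNReal.ofReal_le_ofReal (hT i)
        _ = (1 + c) * μ (⋃ i, ⋃ s ∈ S i, s • B i) := by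
            rw [← Finset.mul_sum, measure_castle hC hB hμ]
        _ = c * μ (⋃ i, ⋃ s ∈ S i, s • B i) + μ (⋃ i, ⋃ s ∈ S i, s • B i) := by
            rw [add_mul, one_mul, add_comm]
        _ ≤ c * 1 + μ (⋃ i, ⋃ s ∈ S i, s • B i) := by gcongr; exact prob_le_one
        _ = _ := by rw [mul_one]
    have hone : 1 ≤ c + (c + μ (⋃ i, ⋃ s ∈ S i, s • B i)) := by
      calc (1 : ENNReal) = μ Set.univ := measure_univ.symm
        _ ≤ μ (W ∪ ⋃ i, ⋃ s ∈ T i, s • B i) := measure_mono fun y _ => hcov y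
        _ ≤ μ W + μ (⋃ i, ⋃ s ∈ T i, s • B i) := measure_union_le _ _
        _ ≤ _ := add_le_add (hW μ hμ) hsum
    rw [← compl_eq_univ_sdiff, prob_compl_eq_one_sub hopen.measurableSet, tsub_le_iff_right,
      ENNReal.ofReal_add (by positivity) (by positivity), add_assoc]
    exact hone
  refine (iSup_le key).trans_lt ((ENNReal.ofReal_lt_ofReal_iff hε).2 (by linarith))

end Castle

section Voronoi

variable {G : Type*} [Group G] {p : G → ℤ} (hp : LineCoord p)

/-- The group elements with coordinate of absolute value less than `n`. -/
noncomputable def LineCoord.window (n : ℕ) : Finset G := hp.cell (Finset.Ioo (-n : ℤ) n)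

theorem LineCoord.mem_window {n : ℕ} {g : G} : g ∈ hp.window n ↔ |p g| < n := by
  simp [LineCoord.window, abs_lt]

open Classical in
/-- The Voronoi cell of the identity among the markers in `R`. -/
noncomputable def LineCoord.vor (n : ℕ) (R : Finset G) : Finset G :=
  hp.cell (voronoi n ((R.erase 1).image p))

theorem LineCoord.mem_vor {n : ℕ} {R : Finset G} {g : G} :
    g ∈ hp.vor n R ↔ |p g| < n ∧ ∀ h ∈ R, h ≠ 1 → |p g| < |p g - p h| := by
  simp only [LineCoord.vor, LineCoord.mem_cell, mem_voronoi, Finset.forall_mem_image,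
    Finset.mem_erase, and_imp]
  exact and_congr_right fun _ => ⟨fun h k hk hk1 => h hk1 hk, fun h k hk1 hk => h k hk hk1⟩

theorem LineCoord.mem_mul_vor [DecidableEq G] {n : ℕ} (hn : 0 < n) {R : Finset G}
    (hR : ∀ h ∈ R, h ≠ 1 → (n : ℤ) ≤ |p h|) {g : G} (hg : |p g| < n)
    (hgR : ∀ h ∈ R, h ≠ 1 → |p g| ≤ |p g - p h|) : g ∈ hp.window 2 * hp.vor n R := by
  classical
  obtain ⟨i, hi, hgi⟩ := exists_mem_voronoi_near (Q := (R.erase 1).image p) hn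
    (by
      simp only [Finset.forall_mem_image, Finset.mem_erase, and_imp]
      exact fun h h1 hh => hR h hh h1)
    hg
    (by
      simp only [Finset.forall_mem_image, Finset.mem_erase, and_imp]
      exact fun h h1 hh => hgR h hh h1)
  obtain ⟨s, rfl⟩ := hp.surj i
  refine Finset.mem_mul.2 ⟨g * s⁻¹, ?_, s, ?_, by simp⟩
  · rw [hp.mem_window, hp.abs_mul_inv]
    exact hgi.trans_lt (by norm_num)
  · simp only [LineCoord.vor, LineCoord.mem_cell]
    convert hi

/-- Voronoi cells of different markers are disjoint. -/
theorem LineCoord.vor_disjoint {n : ℕ} {R R' : Finset G} {g g' : G} (hg : g ∈ hp.vor n R)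
    (hg' : g' ∈ hp.vor n R') (hR : g'⁻¹ * g ∈ hp.window (2 * n) → g'⁻¹ * g ∈ R)
    (hR' : g⁻¹ * g' ∈ hp.window (2 * n) → g⁻¹ * g' ∈ R') : g = g' := by
  by_contra hne
  rw [hp.mem_vor] at hg hg'
  obtain ⟨k, rfl⟩ : ∃ k, g = g' * k := ⟨g'⁻¹ * g, by simp⟩
  rw [inv_mul_cancel_left] at hR
  rw [mul_inv_rev, inv_mul_cancel_right] at hR'
  have hk : k ≠ 1 := by rintro rfl; simp at hne
  have h1 : |p g'| = |p (g' * k) - p k| := by simpa using hp.abs_mul_inv (g' * k) k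
  have h2 : |p g' - p k⁻¹| = |p (g' * k)| := by
    have := hp.abs_mul_inv g' k⁻¹
    rw [inv_inv] at this
    exact this.symm
  have h3 : |p k| < (2 * n : ℕ) := by
    have h4 : |p k| ≤ |p (g' * k)| + |p (g' * k) - p k| := by
      have := abs_sub (p (g' * k)) (p (g' * k) - p k)
      simpa using this
    have := hg.1
    have := hg'.1
    push_cast
    omega
  have h5 := hg.2 k (hR (hp.mem_window.2 h3)) hk
  have h6 := hg'.2 k⁻¹ (hR' (hp.mem_window.2 (by rwa [hp.abs_inv]))) (inv_ne_one.2 hk)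
  omega

end Voronoi

section Backward

section Visits

variable {G : Type*} [Group G] {X : Type*} [TopologicalSpace X] [MulAction G X]

/-- The points of `D` whose visits to `C` within the finite window `L` occur robustly at exactly
the times in `R`. -/
def visits (L R : Finset G) (D C : Set X) : Set X :=
  D ∩ ⋂ h ∈ L, {x | (h ∈ R → h • x ∈ C) ∧ (h ∉ R → h • x ∉ closure C)}

theorem isOpen_visits [ContinuousConstSMul G X] {L R : Finset G} {D C : Set X} (hD : IsOpen D)
    (hC : IsOpen C) : IsOpen (visits L R D C) := by
  refine hD.inter (isOpen_biInter_finset fun h _ => ?_)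
  by_cases hR : h ∈ R
  · have : {x : X | (h ∈ R → h • x ∈ C) ∧ (h ∉ R → h • x ∉ closure C)} = (fun x => h • x) ⁻¹' C := by
      ext; simp [hR]
    rw [this]
    exact hC.preimage (continuous_const_smul h)
  · have : {x : X | (h ∈ R → h • x ∈ C) ∧ (h ∉ R → h • x ∉ closure C)} =
        (fun x => h • x) ⁻¹' (closure C)ᶜ := by
      ext; simp [hR]
    rw [this]
    exact isClosed_closure.isOpen_compl.preimage (continuous_const_smul h)

theorem mem_of_mem_visits {L R : Finset G} {D C : Set X} {x : X} (hx : x ∈ visits L R D C) {h : G}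
    (hL : h ∈ L) (hC : h • x ∈ C) : h ∈ R := by
  by_contra hR
  exact (mem_iInter₂.1 hx.2 h hL).2 hR (subset_closure hC)

theorem mem_visits_filter [DecidableEq G] {L : Finset G} {D C : Set X} {x : X}
    [DecidablePred fun h : G => h • x ∈ C] (hC : IsOpen C)
    (hxD : x ∈ D) (hx : ∀ h ∈ L, h • x ∉ frontier C) :
    x ∈ visits L (L.filter fun h => h • x ∈ C) D C := by
  refine ⟨hxD, mem_iInter₂.2 fun h hL => ⟨fun hh => (Finset.mem_filter.1 hh).2, fun hh hcl => ?_⟩⟩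
  refine hx h hL ?_
  rw [hC.frontier_eq]
  exact ⟨hcl, fun hxC => hh (Finset.mem_filter.2 ⟨hL, hxC⟩)⟩

end Visits

variable {G : Type*} [Group G] {X : Type*} [MetricSpace X] [CompactSpace X] [MulAction G X]
  [MeasurableSpace X] [BorelSpace X] [ContinuousConstSMul G X]

theorem almostFiniteInMeasure_of_essFree_of_sbp {p : G → ℤ} (hp : LineCoord p)
    (hfree : EssFree G X) (hsbp : SBP G X) : AlmostFiniteInMeasure G X := by
  classical
  refine almostFiniteInMeasure_of_expansions fun K ε hε => ?_
  obtain ⟨M₀, hM₀⟩ := hp.exists_isFolner (K ∪ hp.window 2) hε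
  obtain ⟨M, hM, hM1⟩ : ∃ M, M₀ ≤ M ∧ 0 < M := ⟨M₀ + 1, by omega, by omega⟩
  set n := 2 * M with hn
  have hL1 : (1 : G) ∈ hp.window n := by rw [hp.mem_window, hp.one]; simp; omega
  have hLinv : ∀ g ∈ hp.window n, g⁻¹ ∈ hp.window n := by
    intro g hg
    rw [hp.mem_window] at hg ⊢
    rwa [hp.abs_inv]
  obtain ⟨N, D, W, hD, hDd, hDt, hsep, hdiam, hW, hcov⟩ := exists_markers hfree hsbp hL1 hLinv hε
    (c := ENNReal.ofReal ε) (by simpa using hε)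
  set C : Set X := ⋃ i, D i with hC
  set L := hp.window (2 * n) with hL
  let 𝓡 : Finset (Finset G) := L.powerset.filter fun R => ∀ h ∈ R, h ≠ 1 → (n : ℤ) ≤ |p h|
  have h𝓡 : ∀ R : 𝓡, ∀ h ∈ (R : Finset G), h ≠ 1 → (n : ℤ) ≤ |p h| := fun R =>
    (Finset.mem_filter.1 R.2).2
  have hfol : ∀ R : 𝓡, IsFolner (K ∪ hp.window 2) (hp.vor n R) ε := by
    intro R
    refine hM₀ _ (fun a ha c hc b => voronoi_ordConnected a ha c hc b)
      (hM.trans (le_card_voronoi ?_))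
    simp only [Finset.forall_mem_image, Finset.mem_erase, and_imp]
    intro h h1 hh
    simpa [hn] using h𝓡 R h hh h1
  obtain ⟨e⟩ : Nonempty (Fin (Fintype.card 𝓡) ≃ 𝓡) := ⟨(Fintype.equivFin 𝓡).symm⟩
  refine ⟨Fin N × Fin (Fintype.card 𝓡), inferInstance, fun q => hp.vor n (e q.2),
    fun q => visits L (e q.2) (D q.1) C, fun q => (K ∪ hp.window 2) * hp.vor n (e q.2),
    W ∪ ⋃ g ∈ hp.window n, ⋃ h ∈ L, (g * h⁻¹) • frontier C, ?_, ?_, ?_, ?_, ?_, ?_, ?_⟩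
  · rintro ⟨i, r⟩ ⟨j, r'⟩ s hs t ht hne
    refine Set.disjoint_left.2 fun y hy hy' => hne ?_
    obtain ⟨x, hx, rfl⟩ := hy
    obtain ⟨x', hx', hxx'⟩ := hy'
    have hxx : t • x' = s • x := hxx'
    have hxC : x ∈ C := mem_iUnion.2 ⟨i, hx.1⟩
    have hxC' : x' ∈ C := mem_iUnion.2 ⟨j, hx'.1⟩
    have hst : s = t := by
      refine hp.vor_disjoint hs ht (fun hw => mem_of_mem_visits hx hw ?_)
        (fun hw => mem_of_mem_visits hx' hw ?_)
      · rwa [mul_smul, ← hxx, inv_smul_smul]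
      · rwa [mul_smul, hxx, inv_smul_smul]
    subst hst
    obtain rfl : x' = x := smul_left_cancel _ hxx
    have hij : i = j := by
      by_contra hij
      exact Set.disjoint_left.1 (hDd hij) hx.1 hx'.1
    subst hij
    have hsub : ∀ r r' : Fin (Fintype.card 𝓡), x' ∈ visits L (e r) (D i) C →
        x' ∈ visits L (e r') (D i) C → (e r : Finset G) ⊆ e r' := by
      intro r r' h1 h2 h hh
      have hhL : h ∈ L := Finset.mem_powerset.1 (Finset.mem_filter.1 (e r).2).1 hh
      exact mem_of_mem_visits h2 hhL ((mem_iInter₂.1 h1.2 h hhL).1 hh)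
    have : r = r' := e.injective (Subtype.ext (subset_antisymm (hsub r r' hx hx') (hsub r' r hx' hx)))
    rw [this]
  · exact fun q => isOpen_visits (hD _) hDt.1
  · exact fun q => (hfol _).mono Finset.subset_union_left le_rfl
  · intro q s hs
    refine lt_of_le_of_lt (Metric.diam_mono (Set.smul_set_mono inter_subset_left)
      Metric.isBounded_of_compactSpace) (hdiam q.1 s ?_)
    exact hp.mem_window.2 (hp.mem_vor.1 hs).1
  · exact fun q => (hfol _).card_mul_le
  · intro μ hμ
    have hnull : μ (⋃ g ∈ hp.window n, ⋃ h ∈ L, (g * h⁻¹) • frontier C) = 0 :=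
      (measure_biUnion_null_iff (Finset.countable_toSet (hp.window n))).2 fun g _ =>
        (measure_biUnion_null_iff (Finset.countable_toSet L)).2 fun h _ => hDt.2.smul _ μ hμ
    refine (measure_union_le _ _).trans ?_
    rw [hnull, add_zero]
    exact (hW μ hμ).le
  · intro y
    by_cases hyW : y ∈ W
    · exact Or.inl (Or.inl hyW)
    by_cases hyN : y ∈ ⋃ g ∈ hp.window n, ⋃ h ∈ L, (g * h⁻¹) • frontier C
    · exact Or.inl (Or.inr hyN)
    right
    have hex := (hcov y).resolve_left hyW
    obtain ⟨g, hg, hmin⟩ := Finset.exists_min_image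
      ((hp.window n).filter fun g => g⁻¹ • y ∈ C) (fun g => |p g|)
      (by obtain ⟨g, hg, hgy⟩ := hex; exact ⟨g, Finset.mem_filter.2 ⟨hg, hgy⟩⟩)
    obtain ⟨hgw, hgC⟩ := Finset.mem_filter.1 hg
    set x := g⁻¹ • y with hx
    have hgx : g • x = y := smul_inv_smul g y
    obtain ⟨i, hi⟩ := mem_iUnion.1 hgC
    have hfr : ∀ h ∈ L, h • x ∉ frontier C := by
      intro h hh hf
      refine hyN (mem_iUnion₂.2 ⟨g, hgw, mem_iUnion₂.2 ⟨h, hh, ?_⟩⟩)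
      exact ⟨h • x, hf, by simp [← hgx, mul_smul]⟩
    set R := L.filter fun h => h • x ∈ C with hRdef
    have hRsep : ∀ h ∈ R, h ≠ 1 → (n : ℤ) ≤ |p h| := by
      intro h hh h1
      by_contra! hlt
      exact hsep x hgC h (hp.mem_window.2 hlt) h1 (Finset.mem_filter.1 hh).2
    have hR𝓡 : R ∈ 𝓡 :=
      Finset.mem_filter.2 ⟨Finset.mem_powerset.2 (Finset.filter_subset _ _), hRsep⟩
    obtain ⟨r, hr⟩ := e.surjective ⟨R, hR𝓡⟩
    have hxv : x ∈ visits L (e r) (D i) C := by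
      rw [hr]
      exact mem_visits_filter hDt.1 hi hfr
    refine mem_iUnion.2 ⟨(i, r), mem_iUnion₂.2 ⟨g, ?_, ⟨x, hxv, hgx⟩⟩⟩
    refine Finset.mul_subset_mul_right Finset.subset_union_right
      (hp.mem_mul_vor (by omega) (h𝓡 _) (hp.mem_window.1 hgw) ?_)
    rw [hr]
    intro h hh h1
    rw [← hp.abs_mul_inv]
    by_cases hw : g * h⁻¹ ∈ hp.window n
    · refine hmin _ (Finset.mem_filter.2 ⟨hw, ?_⟩)
      have : (g * h⁻¹)⁻¹ • y = h • x := by simp [hx, mul_smul]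
      rw [this]
      exact (Finset.mem_filter.1 hh).2
    · rw [hp.mem_window, not_lt] at hw
      exact (hp.mem_window.1 hgw).le.trans hw

end Backward

section Coordinates

theorem exists_lineCoord {Γ : Type*} [Group Γ] {H : Subgroup Γ} [H.Normal] [Finite H]
    (hG : Nonempty ((Γ ⧸ H) ≃* Multiplicative ℤ) ∨ Nonempty ((Γ ⧸ H) ≃* DihedralGroup 0)) :
    ∃ p : Γ → ℤ, LineCoord p := by
  have hfib : ∀ q : Γ ⧸ H, ((QuotientGroup.mk : Γ → Γ ⧸ H) ⁻¹' {q}).Finite := by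
    intro q
    obtain ⟨g, rfl⟩ := QuotientGroup.mk_surjective q
    refine ((Set.toFinite (H : Set Γ)).image fun h => g * h).subset fun x hx => ?_
    exact ⟨g⁻¹ * x, QuotientGroup.eq.1 (Eq.symm hx), by simp⟩
  rcases hG with ⟨⟨φ⟩⟩ | ⟨⟨φ⟩⟩
  · refine ⟨fun g => (φ (g : Γ ⧸ H)).toAdd, by simp, fun g h k => by simp, fun n => ?_, ?_⟩
    · obtain ⟨g, hg⟩ := QuotientGroup.mk_surjective (φ.symm (Multiplicative.ofAdd n))
      exact ⟨g, by simp [hg]⟩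
    · refine (hfib 1).subset fun g hg => ?_
      have h1 : φ (g : Γ ⧸ H) = 1 := hg
      exact (map_eq_one_iff φ φ.injective).1 h1
  · let d : DihedralGroup 0 → ℤ := fun x => match x with
      | .r i => i
      | .sr i => i
    have hd : ∀ a b c : DihedralGroup 0, |d (a * c) - d (b * c)| = |d a - d b| := by
      rintro (i | i) (j | j) (k | k) <;>
      · simp only [DihedralGroup.r_mul_r, DihedralGroup.r_mul_sr, DihedralGroup.sr_mul_r,
          DihedralGroup.sr_mul_sr, d]
        change ℤ at i j k
        first
          | exact congrArg abs (by ring : (i + k) - (j + k) = i - j)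
          | exact (congrArg abs (by ring : (k - i) - (k - j) = j - i)).trans (abs_sub_comm j i)
    refine ⟨fun g => d (φ (g : Γ ⧸ H)), ?_, fun g h k => ?_, fun n => ?_, ?_⟩
    · simp only [QuotientGroup.mk_one, map_one]
      rfl
    · simp only [QuotientGroup.mk_mul, map_mul]
      exact hd _ _ _
    · obtain ⟨g, hg⟩ := QuotientGroup.mk_surjective (φ.symm (DihedralGroup.r n))
      exact ⟨g, by simp [hg, d]⟩
    · refine ((hfib (φ.symm (.r 0))).union (hfib (φ.symm (.sr 0)))).subset fun g hg => ?_
      have hg' : d (φ (g : Γ ⧸ H)) = 0 := hg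
      simp only [mem_union, mem_preimage, mem_singleton_iff, MulEquiv.eq_symm_apply]
      revert hg'
      rcases φ (g : Γ ⧸ H) with i | i <;> intro hi
      · exact Or.inl (congrArg DihedralGroup.r hi)
      · exact Or.inr (congrArg DihedralGroup.sr hi)

end Coordinates

section FreeMinimal

/-- A compact homogeneous space with an isolated point is finite. -/
theorem finite_of_isOpen_singleton (G : Type*) [Group G] {Y : Type*} [TopologicalSpace Y]
    [CompactSpace Y] [MulAction G Y] [ContinuousConstSMul G Y] [MulAction.IsPretransitive G Y] {y : Y}
    (hy : IsOpen ({y} : Set Y)) : Finite Y := by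
  have : DiscreteTopology Y := by
    refine discreteTopology_iff_isOpen_singleton.2 fun z => ?_
    obtain ⟨g, rfl⟩ := MulAction.exists_smul_eq G y z
    simpa using hy.smul g
  exact finite_of_compact_of_discrete

/-- A countable compact Hausdorff homogeneous space is finite. -/
theorem finite_of_countable_of_isPretransitive (G : Type*) [Group G] (Y : Type*)
    [TopologicalSpace Y] [CompactSpace Y] [MulAction G Y] [ContinuousConstSMul G Y]
    [MulAction.IsPretransitive G Y] [T2Space Y] [Countable Y] : Finite Y := by
  rcases isEmpty_or_nonempty Y with _ | _
  · infer_instance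
  obtain ⟨y, hy⟩ := nonempty_interior_of_iUnion_of_closed (f := fun y : Y => ({y} : Set Y))
    (fun _ => isClosed_singleton) (iUnion_of_singleton Y)
  obtain ⟨z, hz⟩ := hy
  refine finite_of_isOpen_singleton G (y := y) ?_
  have hzy : z = y := mem_singleton_iff.1 (interior_subset hz)
  subst hzy
  have : interior ({z} : Set Y) = {z} :=
    interior_subset.antisymm (singleton_subset_iff.2 hz)
  exact this ▸ isOpen_interior

/-- Translation by a nontrivial element is properly `3`-colourable. -/
theorem exists_colouring {G : Type*} [Group G] {s : G} (hs : s ≠ 1) :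
    ∃ c : G → Fin 3, ∀ g, c g ≠ c (g * s) := by
  have hex : ∀ g : G, ∃ k : ℤ, s ^ k = (g : G ⧸ Subgroup.zpowers s).out⁻¹ * g := fun g =>
    Subgroup.mem_zpowers_iff.1 (QuotientGroup.eq.1 (QuotientGroup.out_eq' _))
  choose k hk using hex
  have hn : orderOf s ≠ 1 := fun h => hs (orderOf_eq_one_iff.1 h)
  have hstep : ∀ g, k (g * s) % orderOf s = (k g + 1) % orderOf s := fun g => by
    refine zpow_eq_zpow_iff_modEq.1 ?_
    have hmk : ((g * s : G) : G ⧸ Subgroup.zpowers s) = (g : G ⧸ Subgroup.zpowers s) :=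
      QuotientGroup.mk_mul_of_mem g (Subgroup.mem_zpowers s)
    rw [hk, hmk, zpow_add_one, hk, mul_assoc]
  generalize orderOf s = n at hn hstep
  let f : ℤ → Fin 3 := fun i =>
    if n ≠ 0 ∧ i = n - 1 then 2 else if i % 2 = 0 then 0 else 1
  have hf : ∀ i : ℤ, f (i % n) ≠ f ((i + 1) % n) := by
    intro i
    rcases Nat.eq_zero_or_pos n with rfl | hpos
    · simp only [f, Nat.cast_zero, Int.emod_zero]
      split_ifs <;> first | decide | omega
    · have h0 := Int.emod_nonneg i (by omega : (n : ℤ) ≠ 0)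
      have h1 := Int.emod_lt_of_pos i (by omega : (0 : ℤ) < n)
      rw [← Int.emod_add_emod]
      generalize i % n = j at h0 h1
      by_cases hj : j = n - 1
      · have h2 : (j + 1) % n = 0 := by simp [hj]
        rw [h2]
        simp only [f]
        split_ifs <;> first | decide | omega
      · rw [Int.emod_eq_of_lt (by omega : 0 ≤ j + 1) (by omega)]
        simp only [f]
        split_ifs <;> first | decide | omega
  exact ⟨fun g => f (k g % n), fun g => by simpa only [hstep] using hf (k g)⟩

/-- Every nonempty compact invariant set contains a minimal one. -/
theorem exists_minimal_subset {G : Type*} [Group G] {Y : Type*} [TopologicalSpace Y]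
    [CompactSpace Y] [MulAction G Y] {P : Set Y} (hP : IsClosed P) (hne : P.Nonempty)
    (hinv : ∀ g : G, ∀ y ∈ P, g • y ∈ P) :
    ∃ M ⊆ P, IsClosed M ∧ M.Nonempty ∧ (∀ g : G, ∀ y ∈ M, g • y ∈ M) ∧
      ∀ N ⊆ M, IsClosed N → N.Nonempty → (∀ g : G, ∀ y ∈ N, g • y ∈ N) → N = M := by
  obtain ⟨M, hMP, hM⟩ := zorn_superset_nonempty
    {N : Set Y | IsClosed N ∧ N.Nonempty ∧ ∀ g : G, ∀ y ∈ N, g • y ∈ N}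
    (fun c hc hchain hcne => by
      refine ⟨⋂₀ c, ⟨isClosed_sInter fun N hN => (hc hN).1, ?_, fun g y hy N hN =>
        (hc hN).2.2 g y (hy N hN)⟩, fun N hN => sInter_subset_of_mem hN⟩
      have := hcne.to_subtype
      exact IsCompact.nonempty_sInter_of_directed_nonempty_isCompact_isClosed
        (IsChain.directedOn (r := fun A B : Set Y => A ⊇ B) hchain.symm)
        (fun N hN => (hc hN).2.1) (fun N hN => (hc hN).1.isCompact)
        fun N hN => (hc hN).1)
    P ⟨hP, hne, hinv⟩
  exact ⟨M, hMP, hM.prop.1, hM.prop.2.1, hM.prop.2.2, fun N hNM h1 h2 h3 =>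
    hNM.antisymm (hM.le_of_le ⟨h1, h2, h3⟩ hNM)⟩

/-- Families of `3`-colourings of a group, indexed by the group itself. -/
def Colourings (G : Type*) : Type _ := G → G → Fin 3

namespace Colourings

variable {G : Type*}

instance : TopologicalSpace (Colourings G) := inferInstanceAs (TopologicalSpace (G → G → Fin 3))

instance : CompactSpace (Colourings G) := inferInstanceAs (CompactSpace (G → G → Fin 3))

instance : T2Space (Colourings G) := inferInstanceAs (T2Space (G → G → Fin 3))

instance : TotallyDisconnectedSpace (Colourings G) :=
  inferInstanceAs (TotallyDisconnectedSpace (G → G → Fin 3))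

instance [Countable G] : TopologicalSpace.MetrizableSpace (Colourings G) :=
  inferInstanceAs (TopologicalSpace.MetrizableSpace (G → G → Fin 3))

theorem continuous_eval (s g : G) : Continuous fun x : Colourings G => x s g :=
  (continuous_apply g).comp (continuous_apply (A := fun _ : G => G → Fin 3) s)

variable [Group G]

instance : MulAction G (Colourings G) where
  smul γ x := fun s g => x s (γ⁻¹ * g)
  one_smul x := by
    funext s g
    exact congrArg (x s) (by simp)
  mul_smul a b x := by
    funext s g
    exact congrArg (x s) (by simp [mul_assoc])

theorem smul_apply (γ : G) (x : Colourings G) (s g : G) : (γ • x) s g = x s (γ⁻¹ * g) := rfl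

instance : ContinuousConstSMul G (Colourings G) where
  continuous_const_smul γ :=
    continuous_pi fun s => continuous_pi fun g => continuous_eval s (γ⁻¹ * g)

variable (G) in
/-- Families whose `s`-th member is a proper colouring for right translation by `s`. -/
def proper : Set (Colourings G) := {x | ∀ s ≠ 1, ∀ g, x s g ≠ x s (g * s)}

theorem isClosed_proper : IsClosed (proper G) := by
  simp only [proper, Set.ofPred_forall]
  refine isClosed_iInter fun s => isClosed_iInter fun _ => isClosed_iInter fun g => ?_
  have : IsClosed {q : Fin 3 × Fin 3 | q.1 ≠ q.2} := isClosed_discrete _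
  exact this.preimage ((continuous_eval s g).prodMk (continuous_eval s (g * s)))

theorem proper_nonempty : (proper G).Nonempty := by
  choose c hc using fun s : {s : G // s ≠ 1} => exists_colouring s.2
  classical
  refine ⟨fun s g => if h : s ≠ 1 then c ⟨s, h⟩ g else 0, fun s hs g => ?_⟩
  simpa [hs] using hc ⟨s, hs⟩ g

theorem smul_mem_proper (γ : G) {x : Colourings G} (hx : x ∈ proper G) : γ • x ∈ proper G := by
  intro s hs g
  rw [smul_apply, smul_apply, ← mul_assoc]
  exact hx s hs _

theorem smul_ne {x : Colourings G} (hx : x ∈ proper G) {s : G} (hs : s ≠ 1) : s • x ≠ x := by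
  intro h
  refine hx s hs 1 ?_
  have := congrFun (congrFun h s) s
  rw [smul_apply, inv_mul_cancel] at this
  rw [this, one_mul]

end Colourings

/-- Every countable infinite group acts freely and minimally on a Cantor set. -/
theorem exists_free_minimal (G : Type*) [Group G] [Countable G] [Infinite G] :
    ∃ (Z : Type) (_ : MetricSpace Z) (_ : CompactSpace Z) (_ : Nonempty Z)
      (_ : TotallyDisconnectedSpace Z) (_ : MulAction G Z) (_ : ContinuousConstSMul G Z),
      Perfect (univ : Set Z) ∧ Minimal G Z ∧ ∀ g : G, g ≠ 1 → ∀ z : Z, g • z ≠ z := by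
  let G₀ := Shrink.{0} G
  let e : G ≃* G₀ := (Shrink.mulEquiv.{0} (α := G)).symm
  have : Countable G₀ := e.symm.injective.countable
  obtain ⟨M, hMP, hMc, hMne, hMinv, hMmin⟩ := exists_minimal_subset (G := G₀)
    Colourings.isClosed_proper Colourings.proper_nonempty
    fun g y hy => Colourings.smul_mem_proper g hy
  let act : MulAction G M :=
    { smul := fun g y => ⟨e g • (y : Colourings G₀), hMinv _ _ y.2⟩
      one_smul := fun y => Subtype.ext (by
        change e 1 • (y : Colourings G₀) = y
        rw [map_one, one_smul])
      mul_smul := fun a b y => Subtype.ext (by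
        change e (a * b) • (y : Colourings G₀) = e a • e b • (y : Colourings G₀)
        rw [map_mul, mul_smul]) }
  have hcoe : ∀ (g : G) (y : M), ((g • y : M) : Colourings G₀) = e g • (y : Colourings G₀) :=
    fun _ _ => rfl
  let : MetricSpace M := TopologicalSpace.metrizableSpaceMetric M
  have hcompact : CompactSpace M := isCompact_iff_compactSpace.1 hMc.isCompact
  have hcont : ContinuousConstSMul G M := ⟨fun g =>
    ((continuous_const_smul (e g)).comp continuous_subtype_val).subtype_mk _⟩
  have hfree : ∀ g : G, g ≠ 1 → ∀ z : M, g • z ≠ z := fun g hg z h =>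
    Colourings.smul_ne (hMP z.2) ((map_ne_one_iff e e.injective).2 hg)
      (congrArg Subtype.val h)
  have hmin : Minimal G M := by
    intro y
    have hcl : IsClosed ((↑) '' closure (MulAction.orbit G y) : Set (Colourings G₀)) :=
      hMc.isClosedEmbedding_subtypeVal.isClosedMap _ isClosed_closure
    have hN := hMmin _ (by rintro _ ⟨z, -, rfl⟩; exact z.2) hcl
      ⟨y, y, subset_closure (MulAction.mem_orbit_self y), rfl⟩ (by
        rintro g _ ⟨z, hz, rfl⟩
        refine ⟨e.symm g • z, ?_, by rw [hcoe, e.apply_symm_apply]⟩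
        refine map_mem_closure (continuous_const_smul (e.symm g)) hz ?_
        intro w hw
        exact MulAction.mem_orbit_of_mem_orbit _ hw)
    intro z
    obtain ⟨w, hw, hwz⟩ := hN.symm.subset z.2
    exact Subtype.ext hwz ▸ hw
  refine ⟨M, inferInstance, hcompact, hMne.to_subtype, inferInstance, act, hcont,
    ⟨isClosed_univ, fun y _ => ?_⟩, hmin, hfree⟩
  rw [accPt_iff_nhds]
  by_contra! hU
  have hy : IsOpen ({y} : Set M) := by
    obtain ⟨U, hU, hy⟩ := hU
    have : ({y} : Set M) ∈ 𝓝 y := by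
      filter_upwards [hU] with z hz using hy z ⟨hz, trivial⟩
    exact isOpen_singleton_iff_nhds_eq_pure y |>.2 (le_antisymm (by simpa using this) (pure_le_nhds y))
  have horb : ∀ z : M, ∃ g : G, g • z = y := by
    intro z
    obtain ⟨w, hw, g, hg⟩ := (hmin z).inter_open_nonempty _ hy ⟨y, rfl⟩
    exact ⟨g, hg.trans hw⟩
  have : MulAction.IsPretransitive G M := ⟨fun a b => by
    obtain ⟨g, hg⟩ := horb a
    obtain ⟨h, hh⟩ := horb b
    exact ⟨h⁻¹ * g, by rw [mul_smul, hg, ← hh, inv_smul_smul]⟩⟩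
  have := finite_of_isOpen_singleton G hy
  refine not_injective_infinite_finite (fun g : G => g • y) fun a b hab => ?_
  by_contra hne
  refine hfree (b⁻¹ * a) (fun h => hne (inv_mul_eq_one.1 h).symm) y ?_
  rw [mul_smul, inv_smul_eq_iff]
  exact hab

/-- If a countable group acts freely on a nonempty compact Hausdorff space with Hausdorff orbit
space, then it is finite. -/
theorem finite_of_t2Space_quotient {H : Type*} [Group H] [Countable H] {Z : Type*}
    [TopologicalSpace Z] [T2Space Z] [CompactSpace Z] [Nonempty Z] [MulAction H Z]
    [ContinuousConstSMul H Z] [T2Space (Quotient (MulAction.orbitRel H Z))]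
    (hfree : ∀ h : H, h ≠ 1 → ∀ z : Z, h • z ≠ z) : Finite H := by
  obtain ⟨z⟩ := ‹Nonempty Z›
  have hcl : IsClosed (MulAction.orbit H z) := by
    have h := (isClosed_singleton (x := (⟦z⟧ : Quotient (MulAction.orbitRel H Z)))).preimage
      continuous_quotient_mk'
    convert h using 1
    ext w
    exact (MulAction.orbitRel_apply (G := H)).symm.trans
      (Quotient.eq (r := MulAction.orbitRel H Z)).symm
  have : CompactSpace (MulAction.orbit H z) := isCompact_iff_compactSpace.1 hcl.isCompact
  have : Countable (MulAction.orbit H z) := (countable_range _).to_subtype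
  have : ContinuousConstSMul H (MulAction.orbit H z) := ⟨fun h =>
    ((continuous_const_smul h).comp continuous_subtype_val).subtype_mk _⟩
  have := finite_of_countable_of_isPretransitive H (MulAction.orbit H z)
  refine Finite.of_injective (fun h : H => (⟨h • z, h, rfl⟩ : MulAction.orbit H z))
    fun a b hab => ?_
  by_contra hne
  refine hfree (b⁻¹ * a) (fun h => hne (inv_mul_eq_one.1 h).symm) z ?_
  rw [mul_smul, inv_smul_eq_iff]
  exact congrArg Subtype.val hab

end FreeMinimal

end Paper

theorem afInMeasure_iff_essFree_and_sbp
    (Γ : Type*) [Group Γ] [Countable Γ]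
    (H : Subgroup Γ) [H.Normal] (hlf : LocallyFiniteGroup H)
    (hG : Nonempty ((Γ ⧸ H) ≃* Multiplicative ℤ) ∨ Nonempty ((Γ ⧸ H) ≃* DihedralGroup 0))
    (hCantor : ∀ (Z : Type) [MetricSpace Z] [CompactSpace Z] [Nonempty Z]
      [TotallyDisconnectedSpace Z] [MeasurableSpace Z] [BorelSpace Z]
      [MulAction Γ Z] [ContinuousConstSMul Γ Z],
      Perfect (Set.univ : Set Z) → Minimal Γ Z → EssFree Γ Z →
        T2Space (Quotient (MulAction.orbitRel H Z)))
    (X : Type*) [MetricSpace X] [CompactSpace X] [Infinite X]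
    [MeasurableSpace X] [BorelSpace X]
    [MulAction Γ X] [ContinuousConstSMul Γ X]
    (hmin : Minimal Γ X) :
    AlmostFiniteInMeasure Γ X ↔ (EssFree Γ X ∧ SBP Γ X) := by
  have hfin : Finite H := by
    by_contra hinf
    have : Infinite Γ := not_finite_iff_infinite.1 fun _ => hinf inferInstance
    obtain ⟨Z, _, _, _, _, _, _, hperf, hZmin, hfree⟩ := exists_free_minimal Γ
    let _ : MeasurableSpace Z := borel Z
    have : BorelSpace Z := ⟨rfl⟩
    have hZfree : EssFree Γ Z := fun g hg μ _ => by
      have : {z : Z | g • z = z} = ∅ := Set.eq_empty_of_forall_notMem (hfree g hg)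
      rw [this, measure_empty]
    have : ContinuousConstSMul H Z := ⟨fun h => continuous_const_smul (h : Γ)⟩
    have := hCantor Z hperf hZmin hZfree
    exact hinf (finite_of_t2Space_quotient (Z := Z) fun h hh z =>
      hfree h (fun h1 => hh (Subtype.ext h1)) z)
  obtain ⟨p, hp⟩ := exists_lineCoord hG
  exact ⟨fun h => ⟨h.essFree, h.sbp⟩, fun h => almostFiniteInMeasure_of_essFree_of_sbp hp h.1 h.2⟩
end

section
/- Every minimal continuous action of the infinite dihedral group D∞ on an infinite compact Hausdorff space X is essentially free. -/
open scoped Pointwise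
open MeasureTheory

open Paper

/-- The rotation of the infinite dihedral group with a given integer index. -/
def intRotation (i : ℤ) : DihedralGroup 0 := DihedralGroup.r i

/-- The reflection of the infinite dihedral group with a given integer index. -/
def intReflection (i : ℤ) : DihedralGroup 0 := DihedralGroup.sr i

theorem intRotation_mul_intRotation (i j : ℤ) :
    intRotation i * intRotation j = intRotation (i + j) := rfl

theorem intRotation_mul_intReflection (i j : ℤ) :
    intRotation i * intReflection j = intReflection (j - i) := rfl

theorem intReflection_mul_intRotation (i j : ℤ) :
    intReflection i * intRotation j = intReflection (i + j) := rfl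

theorem intReflection_mul_intReflection (i j : ℤ) :
    intReflection i * intReflection j = intRotation (j - i) := rfl

theorem intRotation_zpow (i k : ℤ) : intRotation i ^ k = intRotation (i * k) :=
  (DihedralGroup.r_zpow _ k).trans (congrArg (fun m : ℤ => intRotation (i * m)) Int.cast_id)

theorem eq_intRotation_or_eq_intReflection (g : DihedralGroup 0) :
    (∃ i, g = intRotation i) ∨ ∃ i, g = intReflection i := by
  rcases g with i | i
  exacts [Or.inl ⟨i, rfl⟩, Or.inr ⟨i, rfl⟩]

/-- An infinite T1 space with a minimal action of the infinite dihedral group has no point fixed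
by a nontrivial rotation. -/
theorem Paper.Minimal.intRotation_smul_ne {X : Type*} [TopologicalSpace X] [T1Space X] [Infinite X]
    [MulAction (DihedralGroup 0) X] (hmin : Minimal (DihedralGroup 0) X)
    {i : ℤ} (hi : i ≠ 0) (x : X) : intRotation i • x ≠ x := by
  intro hx
  have hpow (k : ℤ) : intRotation (i * k) • x = x := by
    rw [← intRotation_zpow]
    exact zpow_mem (MulAction.mem_stabilizer_iff.2 hx) k
  have hfin : (MulAction.orbit (DihedralGroup 0) x).Finite := by
    have hI : (Set.Ico (0 : ℤ) |i|).Finite := Set.finite_Ico _ _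
    refine ((hI.image fun j => intRotation j • x).union
      (hI.image fun j => intReflection j • x)).subset ?_
    have hmod (j : ℤ) : j % i ∈ Set.Ico (0 : ℤ) |i| :=
      ⟨Int.emod_nonneg j hi, Int.emod_lt_abs j hi⟩
    rintro _ ⟨g, rfl⟩
    obtain ⟨j, rfl⟩ | ⟨j, rfl⟩ := eq_intRotation_or_eq_intReflection g
    · refine Or.inl ⟨_, hmod j, ?_⟩
      have h : intRotation j = intRotation (j % i) * intRotation (i * (j / i)) := by
        rw [intRotation_mul_intRotation, Int.emod_add_mul_ediv]
      simp only [h, mul_smul, hpow]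
    · refine Or.inr ⟨_, hmod j, ?_⟩
      have h : intReflection j = intReflection (j % i) * intRotation (i * (j / i)) := by
        rw [intReflection_mul_intRotation, Int.emod_add_mul_ediv]
      simp only [h, mul_smul, hpow]
  have huniv := (hmin x).closure_eq
  rw [hfin.isClosed.closure_eq] at huniv
  exact Set.infinite_univ (huniv ▸ hfin)

/-- If no nontrivial rotation has a fixed point, the fixed-point set of a reflection is null for
every invariant Borel probability measure: its translates under the rotations are infinitely many
pairwise disjoint sets of equal measure. -/
theorem Paper.InvProb.measure_fixedBy_intReflection_eq_zero {X : Type*} [TopologicalSpace X]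
    [T2Space X] [MeasurableSpace X] [BorelSpace X] [MulAction (DihedralGroup 0) X]
    [ContinuousConstSMul (DihedralGroup 0) X]
    (hfree : ∀ i : ℤ, i ≠ 0 → ∀ x : X, intRotation i • x ≠ x)
    {μ : Measure X} (hμ : InvProb (DihedralGroup 0) X μ) (j : ℤ) :
    μ {x : X | intReflection j • x = x} = 0 := by
  obtain ⟨hprob, hinv⟩ := hμ
  let A : ℤ → Set X := fun k => {x : X | intReflection k • x = x}
  have hmeas (k : ℤ) : MeasurableSet (A k) :=
    (isClosed_eq (continuous_const_smul _) continuous_id).measurableSet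
  have hdisj {k l : ℤ} (hkl : k ≠ l) : Disjoint (A k) (A l) := by
    refine Set.disjoint_left.2 fun x hk hl => hfree (l - k) (sub_ne_zero.2 hkl.symm) x ?_
    rw [← intReflection_mul_intReflection, mul_smul, show intReflection l • x = x from hl]
    exact hk
  have htranslate (k : ℤ) : μ (A (j + k + k)) = μ (A j) := by
    conv_rhs => rw [← hinv (intRotation k)]
    rw [Measure.map_apply (continuous_const_smul _).measurable (hmeas j)]
    congr 1
    ext x
    have h : intReflection j * intRotation k = intRotation k * intReflection (j + k + k) := by
      rw [intRotation_mul_intReflection, intReflection_mul_intRotation, add_sub_cancel_right]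
    change _ ↔ intReflection j • intRotation k • x = intRotation k • x
    rw [← mul_smul, h, mul_smul, smul_left_cancel_iff]
    rfl
  by_contra hne
  have hfin := Measure.finite_const_le_meas_of_disjoint_iUnion μ (pos_iff_ne_zero.2 hne)
    (As := fun k : ℤ => A (j + k + k)) (fun k => hmeas _)
    (fun k l hkl => hdisj (by lia)) (measure_ne_top _ _)
  exact Set.infinite_univ (hfin.subset fun k _ => (htranslate k).ge)

theorem essFree_of_minimal_dihedral
    (X : Type*) [TopologicalSpace X] [CompactSpace X] [T2Space X] [Infinite X]
    [MeasurableSpace X] [BorelSpace X]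
    [MulAction (DihedralGroup 0) X] [ContinuousConstSMul (DihedralGroup 0) X]
    (hmin : Minimal (DihedralGroup 0) X) :
    EssFree (DihedralGroup 0) X := by
  intro g hg μ hμ
  obtain ⟨i, rfl⟩ | ⟨j, rfl⟩ := eq_intRotation_or_eq_intReflection g
  · have hi : i ≠ 0 := fun h => hg (congrArg intRotation h)
    simp [hmin.intRotation_smul_ne hi]
  · exact hμ.measure_fixedBy_intReflection_eq_zero (fun _ => hmin.intRotation_smul_ne) j
end
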